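/- arXiv:2509.00162 — 2 statements merged into one kernel-verified Lean document; each statement's English description precedes it below -/
import Mathlib

section
/- Let x ∈ A^ℤ be a non-periodic Toeplitz sequence over a finite alphabet A with period structure (p_k)_{k≥1}, let X be the closure of the σ-orbit of x, and let c ≥ 2 be an integer such that for some N ∈ ℕ, gcd(c, p_{k+1}/p_k) = 1 for all k ≥ N. Then there exists a continuous function p : X → {1,2,3,...} such that S(y) = σ^{p(y)}(y) is a homeomorphism of X, every S-orbit is dense in X, every σ-orbit in X is the union of exactly c distinct S-orbits, (X,S) is topologically conjugate to the closure of the σ-orbit of some non-periodic Toeplitz sequence z over some finite alphabet having a period structure (q_k)_{k≥1} with the property that every p_k divides some q_j and every q_k divides some p_j (so (X,S) is a Toeplitz flow with the same underlying odometer as (X,σ)), and (X,S) is not topologically conjugate to (X,σ). -/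
open Set Topology Classical

noncomputable section

/-- The left shift `σ` on bi-infinite sequences: `(σ x) n = x (n+1)`. -/
def shiftMap {A : Type} (x : ℤ → A) : ℤ → A := fun n => x (n + 1)

/-- The shift by an integer amount: `shiftZ n x = σ^n x`. -/
def shiftZ {A : Type} (n : ℤ) (x : ℤ → A) : ℤ → A := fun m => x (m + n)

/-- A bi-infinite sequence is Toeplitz if every coordinate is periodically repeated. -/
def IsToeplitz {A : Type} (x : ℤ → A) : Prop :=
  ∀ i : ℤ, ∃ p : ℕ, 0 < p ∧ ∀ k : ℤ, x (i + k * (p : ℤ)) = x i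

/-- The closure of the full shift orbit of `x`. -/
def orbitClosure {A : Type} [TopologicalSpace A] (x : ℤ → A) : Set (ℤ → A) :=
  closure {y | ∃ n : ℤ, shiftZ n x = y}

/-- The finite word `x_i x_{i+1} ⋯ x_{i+n-1}`. -/
def seqWord {A : Type} (x : ℤ → A) (i : ℤ) (n : ℕ) : List A :=
  List.ofFn fun m : Fin n => x (i + (m : ℕ))

/-- Iterates `θ^k` of a substitution, applied to a letter. -/
def substPow {A : Type} (θ : A → List A) : ℕ → A → List A
  | 0, a => [a]
  | k + 1, a => (θ a).flatMap (substPow θ k)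

/-- The substitution subshift of `θ`: all sequences whose finite subwords occur in
some `θ^k(a)`. -/
def substShift {A : Type} (θ : A → List A) : Set (ℤ → A) :=
  {x | ∀ i : ℤ, ∀ n : ℕ, ∃ (k : ℕ) (a : A), (seqWord x i n).IsInfix (substPow θ k a)}

/-- The full orbit of `x` under an (invertible) map `S`, within the set `X`. -/
def orbitIn {α : Type} (S : α → α) (X : Set α) (x : α) : Set α :=
  {y | y ∈ X ∧ ∃ n : ℕ, S^[n] x = y ∨ S^[n] y = x}

/-- Every `S`-orbit within `X` is dense in `X`. -/
def MinimalOn {α : Type} [TopologicalSpace α] (S : α → α) (X : Set α) : Prop :=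
  ∀ x ∈ X, X ⊆ closure (orbitIn S X x)

/-- Every `T`-orbit in `X` is the union of exactly `c` distinct `S`-orbits. -/
def OrbitNumberOn {α : Type} (T S : α → α) (X : Set α) (c : ℕ) : Prop :=
  ∀ x ∈ X, ∃ r : Fin c → α,
    (∀ i, r i ∈ orbitIn T X x) ∧
    (∀ i j, i ≠ j → r j ∉ orbitIn S X (r i)) ∧
    (∀ y ∈ orbitIn T X x, ∃ i, y ∈ orbitIn S X (r i))

/-- `S` restricts to a homeomorphism of the subset `X`. -/
def RestrictsToHomeomorph {α : Type} [TopologicalSpace α] (S : α → α) (X : Set α) : Prop :=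
  ∃ e : X ≃ₜ X, ∀ x : X, (e x : α) = S (x : α)

/-- The systems `(X, S)` and `(Y, R)` are topologically conjugate. -/
def TopConj {α β : Type} [TopologicalSpace α] [TopologicalSpace β]
    (X : Set α) (S : α → α) (Y : Set β) (R : β → β) : Prop :=
  ∃ (hS : Set.MapsTo S X X) (hR : Set.MapsTo R Y Y) (h : X ≃ₜ Y),
    ∀ x : X, h (Set.MapsTo.restrict S X X hS x) = Set.MapsTo.restrict R Y Y hR (h x)

/-- `(Y, R)` is a topological factor of `(X, S)`. -/
def IsFactorOn {α β : Type} [TopologicalSpace α] [TopologicalSpace β]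
    (X : Set α) (S : α → α) (Y : Set β) (R : β → β) : Prop :=
  ∃ F : α → β, Set.MapsTo F X Y ∧ ContinuousOn F X ∧ Set.SurjOn F X Y ∧
    ∀ x ∈ X, F (S x) = R (F x)

/-- `(X, S)` is a Toeplitz flow: it is topologically conjugate to the orbit closure of
some Toeplitz sequence over some finite alphabet, with the shift map. -/
def IsToeplitzFlow {α : Type} [TopologicalSpace α] (X : Set α) (S : α → α) : Prop :=
  ∃ (B : Type) (_ : Fintype B) (z : ℤ → B), IsToeplitz z ∧
    (letI : TopologicalSpace B := ⊥
     TopConj X S (orbitClosure z) shiftMap)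

/-- `Per_p(x)`: the set of positions where `x` is periodic with period `p`. -/
def PerSet {A : Type} (x : ℤ → A) (p : ℕ) : Set ℤ :=
  {k | ∀ n : ℤ, x (k + n * (p : ℤ)) = x k}

/-- `p` is an essential period of `x`. -/
def IsEssentialPeriod {A : Type} (x : ℤ → A) (p : ℕ) : Prop :=
  0 < p ∧ ¬ ∃ q : ℕ, 0 < q ∧ q < p ∧
    ((fun k => k + (q : ℤ)) '' PerSet x p = PerSet x p) ∧
    (∀ k ∈ PerSet x p, x (k + (q : ℤ)) = x k)

/-- A period structure for a Toeplitz sequence `x`. -/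
def IsPeriodStructure {A : Type} (x : ℤ → A) (p : ℕ → ℕ) : Prop :=
  StrictMono p ∧ (∀ k, IsEssentialPeriod x (p k)) ∧
  (∀ k, p k ∣ p (k + 1)) ∧ (⋃ k, PerSet x (p k)) = Set.univ

/-- `x` is a (σ-)periodic sequence. -/
def IsPeriodicSeq {A : Type} (x : ℤ → A) : Prop :=
  ∃ n : ℕ, 0 < n ∧ ∀ m : ℤ, x (m + (n : ℤ)) = x m

/-- `z` is the bi-infinite concatenation of the `ψ`-images of the letters of `y`,
with `ψ(y₀)` beginning at coordinate `0`. -/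
def IsConcat {B C : Type} (ψ : B → List C) (y : ℤ → B) (z : ℤ → C) : Prop :=
  ∃ s : ℤ → ℤ, s 0 = 0 ∧
    (∀ n : ℤ, s (n + 1) = s n + ((ψ (y n)).length : ℤ)) ∧
    (∀ n : ℤ, ∀ j : Fin (ψ (y n)).length, z (s n + (j : ℕ)) = (ψ (y n)).get j)

/-- `p(x,n) = Σ_{i<n} p(Sⁱ x)`. -/
def psum {X : Type} (p : X → ℕ) (S : X → X) (x : X) (n : ℕ) : ℕ :=
  ∑ i ∈ Finset.range n, p (S^[i] x)



section Helpers

theorem shiftZ_add {A : Type} (m n : ℤ) (x : ℤ → A) :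
    shiftZ m (shiftZ n x) = shiftZ (m + n) x := by
  funext k; simp [shiftZ, add_assoc]

theorem shiftZ_zero {A : Type} (x : ℤ → A) : shiftZ 0 x = x := by
  funext k; simp [shiftZ]

theorem shiftMap_iter {A : Type} (n : ℕ) (x : ℤ → A) : shiftMap^[n] x = shiftZ n x := by
  induction n with
  | zero => simp [shiftZ_zero]
  | succ n ih =>
    rw [Function.iterate_succ_apply', ih]
    funext k; simp only [shiftMap, shiftZ]; congr 1; push_cast; ring

theorem mem_closure_seq {A : Type} [TopologicalSpace A] [DiscreteTopology A]
    (S : Set (ℤ → A)) (y : ℤ → A) :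
    y ∈ closure S ↔ ∀ M : ℕ, ∃ s ∈ S, ∀ i : ℤ, -(M : ℤ) ≤ i → i ≤ M → s i = y i := by
  constructor
  · intro h M
    have hopen : IsOpen (Set.pi (Set.Icc (-(M : ℤ)) M) (fun i => ({y i} : Set A))) :=
      isOpen_set_pi (Set.finite_Icc _ _) (fun i _ => isOpen_discrete _)
    obtain ⟨s, hs1, hs2⟩ := mem_closure_iff.1 h _ hopen (by intro i _; rfl)
    exact ⟨s, hs2, fun i h1 h2 => hs1 i ⟨h1, h2⟩⟩
  · intro h
    rw [mem_closure_iff]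
    intro o ho hy
    obtain ⟨I, u, hu, hsub⟩ := isOpen_pi_iff.1 ho y hy
    obtain ⟨s, hs, hsy⟩ := h (I.sup Int.natAbs)
    refine ⟨s, hsub ?_, hs⟩
    intro i hi
    have hle : i.natAbs ≤ I.sup Int.natAbs := Finset.le_sup (f := Int.natAbs) hi
    rw [hsy i (by omega) (by omega)]
    exact (hu i hi).2

theorem shiftZ_continuous {A : Type} [TopologicalSpace A] (n : ℤ) :
    Continuous (shiftZ n : (ℤ → A) → (ℤ → A)) := by
  unfold shiftZ
  fun_prop

theorem shiftZ_mem {A : Type} [TopologicalSpace A] {x y : ℤ → A} (n : ℤ)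
    (hy : y ∈ orbitClosure x) : shiftZ n y ∈ orbitClosure x := by
  have : MapsTo (shiftZ n) {y | ∃ n : ℤ, shiftZ n x = y} {y | ∃ n : ℤ, shiftZ n x = y} := by
    rintro _ ⟨m, rfl⟩
    exact ⟨n + m, (shiftZ_add _ _ _).symm⟩
  exact this.closure (shiftZ_continuous n) hy

theorem shiftZ_self_mem {A : Type} [TopologicalSpace A] (x : ℤ → A) (n : ℤ) :
    shiftZ n x ∈ orbitClosure x := subset_closure ⟨n, rfl⟩

theorem self_mem {A : Type} [TopologicalSpace A] (x : ℤ → A) :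
    x ∈ orbitClosure x := subset_closure ⟨0, shiftZ_zero x⟩

/-! Period sets and their stabilizers. -/

theorem perSet_add {A : Type} {x : ℤ → A} {p : ℕ} {k : ℤ} (h : k ∈ PerSet x p) (n : ℤ) :
    k + n * p ∈ PerSet x p := by
  intro m
  rw [h n, ← h (n + m)]
  congr 1; ring

theorem perSet_add_dvd {A : Type} {x : ℤ → A} {p : ℕ} {k t : ℤ} (h : k ∈ PerSet x p)
    (ht : (p : ℤ) ∣ t) : k + t ∈ PerSet x p := by
  obtain ⟨m, rfl⟩ := ht
  rw [mul_comm]; exact perSet_add h m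

theorem perSet_val {A : Type} {x : ℤ → A} {p : ℕ} {k t : ℤ} (h : k ∈ PerSet x p)
    (ht : (p : ℤ) ∣ t) : x (k + t) = x k := by
  obtain ⟨m, rfl⟩ := ht
  rw [mul_comm]; exact h m

theorem perSet_mono {A : Type} {x : ℤ → A} {p q : ℕ} (h : p ∣ q) :
    PerSet x p ⊆ PerSet x q := by
  intro k hk m
  exact perSet_val hk (Dvd.dvd.mul_left (Int.natCast_dvd_natCast.2 h) m)

/-- the stabilizer of the `p`-skeleton -/
def Stab {A : Type} (x : ℤ → A) (p : ℕ) : AddSubgroup ℤ where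
  carrier := {t | ∀ k ∈ PerSet x p, k + t ∈ PerSet x p ∧ k - t ∈ PerSet x p ∧ x (k + t) = x k}
  zero_mem' := by intro k hk; simpa using hk
  add_mem' := by
    intro a b ha hb k hk
    refine ⟨?_, ?_, ?_⟩
    · have := (hb _ (ha k hk).1).1
      rwa [add_assoc] at this
    · have := (hb _ (ha k hk).2.1).2.1
      rwa [sub_sub] at this
    · have := (hb _ (ha k hk).1).2.2
      rw [← add_assoc, this, (ha k hk).2.2]
  neg_mem' := by
    intro a ha k hk
    refine ⟨?_, ?_, ?_⟩
    · exact (ha k hk).2.1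
    · simpa using (ha k hk).1
    · have := (ha _ (ha k hk).2.1).2.2
      rw [sub_add_cancel] at this
      exact this.symm

theorem stab_mk {A : Type} {x : ℤ → A} {p : ℕ} (hp : 0 < p) {t : ℤ}
    (h : ∀ k ∈ PerSet x p, k + t ∈ PerSet x p ∧ x (k + t) = x k) : t ∈ Stab x p := by
  intro k hk
  refine ⟨(h k hk).1, ?_, (h k hk).2⟩
  have key : ∀ n : ℕ, k + n * t ∈ PerSet x p := by
    intro n
    induction n with
    | zero => simpa using hk
    | succ n ih =>
      have := (h _ ih).1
      convert this using 1
      push_cast; ring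
  have := perSet_add (key (p - 1)) (-t)
  convert this using 1
  push_cast [Nat.cast_sub hp]; ring

theorem mem_stab_self {A : Type} (x : ℤ → A) (p : ℕ) : (p : ℤ) ∈ Stab x p := by
  intro k hk
  refine ⟨perSet_add_dvd hk dvd_rfl, ?_, perSet_val hk dvd_rfl⟩
  rw [sub_eq_add_neg]
  exact perSet_add_dvd hk (by simp)

theorem stab_dvd {A : Type} {x : ℤ → A} {p : ℕ} {t : ℤ} (ht : (p : ℤ) ∣ t) : t ∈ Stab x p := by
  obtain ⟨m, rfl⟩ := ht
  have := (Stab x p).zsmul_mem (mem_stab_self x p) m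
  rwa [smul_eq_mul, mul_comm] at this

theorem ess_iff {A : Type} {x : ℤ → A} {p : ℕ} (hp : 0 < p) :
    IsEssentialPeriod x p ↔ ∀ t ∈ Stab x p, (p : ℤ) ∣ t := by
  have hp' : (0 : ℤ) < p := by exact_mod_cast hp
  constructor
  · rintro ⟨_, h⟩ t ht
    by_contra hnd
    apply h
    have hmod : t % p ∈ Stab x p := by
      rw [Int.emod_def]
      exact (Stab x p).sub_mem ht (stab_dvd (Dvd.intro _ rfl))
    have h0 : 0 ≤ t % p := Int.emod_nonneg _ hp'.ne'
    have h1 : t % p < p := Int.emod_lt_of_pos _ hp'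
    have h2 : t % p ≠ 0 := fun h => hnd (Int.dvd_of_emod_eq_zero h)
    refine ⟨(t % p).toNat, by omega, by omega, ?_, ?_⟩
    · rw [Int.toNat_of_nonneg h0]
      ext k
      constructor
      · rintro ⟨j, hj, rfl⟩
        exact (hmod j hj).1
      · intro hk
        exact ⟨k - t % p, (hmod k hk).2.1, by simp⟩
    · rw [Int.toNat_of_nonneg h0]
      intro k hk
      exact (hmod k hk).2.2
  · intro h
    refine ⟨hp, ?_⟩
    rintro ⟨q, hq0, hq1, himg, hval⟩
    have : (q : ℤ) ∈ Stab x p := by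
      apply stab_mk hp
      intro k hk
      refine ⟨?_, hval k hk⟩
      rw [← himg]
      exact ⟨k, hk, rfl⟩
    have := Int.le_of_dvd (by exact_mod_cast hq0) (h _ this)
    omega

theorem perSet_finset {A : Type} {x : ℤ → A} {p : ℕ → ℕ} (hdiv : ∀ k, p k ∣ p (k + 1))
    (hU : (⋃ k, PerSet x (p k)) = Set.univ) (F : Finset ℤ) (l₀ : ℕ) :
    ∃ l, l₀ ≤ l ∧ ∀ i ∈ F, i ∈ PerSet x (p l) := by
  have hd : ∀ a b, a ≤ b → p a ∣ p b := by
    intro a b hab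
    induction hab with
    | refl => exact dvd_rfl
    | step _ ih => exact ih.trans (hdiv _)
  have hex : ∀ i : ℤ, ∃ k, i ∈ PerSet x (p k) := by
    intro i
    have : i ∈ ⋃ k, PerSet x (p k) := by rw [hU]; trivial
    simpa using this
  choose f hf using hex
  refine ⟨l₀ + F.sup f, Nat.le_add_right _ _, fun i hi => ?_⟩
  exact perSet_mono (hd _ _ ((Finset.le_sup hi).trans (Nat.le_add_left _ _))) (hf i)

/-- Construct a period structure from a divisibility chain. -/
theorem exists_period_structure {B : Type} (z : ℤ → B) (p : ℕ → ℕ) (hpos : ∀ k, 0 < p k)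
    (hmono : StrictMono p)
    (hdiv : ∀ k, p k ∣ p (k + 1)) (hU : (⋃ k, PerSet z (p k)) = Set.univ)
    (hcof : ∀ k, ∃ j, ∀ t ∈ Stab z (p j), (p k : ℤ) ∣ t) :
    ∃ q : ℕ → ℕ, IsPeriodStructure z q ∧ (∀ k, ∃ j, p k ∣ q j) ∧ (∀ k, ∃ j, q k ∣ p j) := by
  have hg : ∀ j, ∃ g : ℕ, ∀ t, t ∈ Stab z (p j) ↔ (g : ℤ) ∣ t := by
    intro j
    obtain ⟨a, ha⟩ := Int.subgroup_cyclic (Stab z (p j))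
    refine ⟨a.natAbs, fun t => ?_⟩
    rw [ha, AddSubgroup.mem_closure_singleton, Int.natAbs_dvd]
    constructor
    · rintro ⟨n, rfl⟩; simp
    · rintro ⟨n, rfl⟩; exact ⟨n, by simp [mul_comm]⟩
  choose g hg using hg
  have hgp : ∀ j, g j ∣ p j := fun j =>
    Int.natCast_dvd_natCast.1 ((hg j _).1 (mem_stab_self z (p j)))
  have hgpos : ∀ j, 0 < g j := fun j => Nat.pos_of_dvd_of_pos (hgp j) (hpos j)
  have hper : ∀ j, PerSet z (g j) = PerSet z (p j) := by
    intro j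
    apply Set.Subset.antisymm (perSet_mono (hgp j))
    intro k hk m
    exact ((hg j (m * g j)).2 (Dvd.intro_left _ rfl) k hk).2.2
  have hess : ∀ j, IsEssentialPeriod z (g j) := by
    intro j
    rw [ess_iff (hgpos j)]
    intro t ht
    rw [← hg j]
    intro k hk
    have := ht k (by rw [hper]; exact hk)
    rwa [hper] at this
  have hgd : ∀ j, g j ∣ g (j + 1) := by
    intro j
    rw [← Int.natCast_dvd_natCast, ← hg j]
    apply stab_mk (hpos j)
    intro k hk
    have hin : ∀ n : ℤ, k + n * p j ∈ PerSet z (g (j + 1)) := by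
      intro n
      rw [hper]
      exact perSet_mono (hdiv j) (perSet_add hk n)
    have h1 : ∀ n : ℤ, z (k + g (j + 1) + n * p j) = z k := by
      intro n
      have := perSet_val (hin n) (dvd_refl (g (j + 1) : ℤ))
      rw [hk n] at this
      rw [← this]; congr 1; ring
    have h2 : z (k + g (j + 1)) = z k := by simpa using h1 0
    refine ⟨?_, h2⟩
    intro n
    rw [h1, h2]
  have hgd' : ∀ a b, a ≤ b → g a ∣ g b := by
    intro a b hab
    induction hab with
    | refl => exact dvd_rfl
    | step _ ih => exact ih.trans (hgd _)
  have hcof' : ∀ k, ∃ j, p k ∣ g j := by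
    intro k
    obtain ⟨j, hj⟩ := hcof k
    refine ⟨j, ?_⟩
    rw [← Int.natCast_dvd_natCast]
    exact hj _ ((hg j _).2 dvd_rfl)
  have htend : Filter.Tendsto g Filter.atTop Filter.atTop := by
    apply Filter.tendsto_atTop_atTop_of_monotone
    · intro a b hab
      exact Nat.le_of_dvd (hgpos b) (hgd' a b hab)
    · intro b
      obtain ⟨j, hj⟩ := hcof' b
      exact ⟨j, (hmono.id_le b).trans (Nat.le_of_dvd (hgpos j) hj)⟩
  obtain ⟨φ, hφ, hgφ⟩ := Filter.strictMono_subseq_of_tendsto_atTop htend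
  refine ⟨g ∘ φ, ⟨hgφ, fun k => hess _, fun k => hgd' _ _ (hφ (Nat.lt_succ_self k)).le, ?_⟩,
    ?_, fun k => ⟨φ k, hgp _⟩⟩
  · rw [Set.eq_univ_iff_forall]
    intro i
    obtain ⟨l, _, hl⟩ := perSet_finset hdiv hU {i} 0
    rw [Set.mem_iUnion]
    refine ⟨l, ?_⟩
    have := hl i (by simp)
    rw [← hper] at this
    exact perSet_mono (hgd' _ _ (hφ.id_le l)) this
  · intro k
    obtain ⟨j, hj⟩ := hcof' k
    exact ⟨j, hj.trans (hgd' _ _ (hφ.id_le j))⟩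

/-! Odometer coordinates -/

/-- `y` carries the `p`-skeleton of `x` shifted by `a`. -/
def InC {A : Type} (x : ℤ → A) (p : ℕ) (a : ℤ) (y : ℤ → A) : Prop :=
  ∀ k ∈ PerSet x p, y (k - a) = x k

theorem isClosed_inC {A : Type} [TopologicalSpace A] [DiscreteTopology A] (x : ℤ → A) (p : ℕ)
    (a : ℤ) : IsClosed {y | InC x p a y} := by
  simp only [InC, Set.ofPred_forall]
  refine isClosed_iInter fun k => isClosed_iInter fun _ => ?_
  exact isClosed_eq (continuous_apply _) continuous_const

theorem inC_self {A : Type} (x : ℤ → A) (p : ℕ) : InC x p 0 x := by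
  intro k _; simp

theorem inC_shift {A : Type} {x y : ℤ → A} {p : ℕ} {a : ℤ} (h : InC x p a y) (n : ℤ) :
    InC x p (a + n) (shiftZ n y) := by
  intro k hk
  rw [← h k hk]
  simp only [shiftZ]; congr 1; ring

theorem inC_congr {A : Type} {x y : ℤ → A} {p : ℕ} {a b : ℤ} (h : InC x p a y)
    (hab : (p : ℤ) ∣ a - b) : InC x p b y := by
  intro k hk
  have := h _ (perSet_add_dvd hk hab)
  rw [perSet_val hk hab] at this
  rw [← this]; congr 1; ring

theorem inC_emod {A : Type} {x y : ℤ → A} {p : ℕ} {a : ℤ} (h : InC x p a y) :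
    InC x p (a % p) y :=
  inC_congr h (Int.dvd_self_sub_emod)

theorem exists_inC {A : Type} [TopologicalSpace A] [DiscreteTopology A] {x y : ℤ → A} {p : ℕ}
    (hp : 0 < p) (hy : y ∈ orbitClosure x) : ∃ a : ℤ, 0 ≤ a ∧ a < p ∧ InC x p a y := by
  have hp' : (0 : ℤ) < p := by exact_mod_cast hp
  have hcl : IsClosed (⋃ a ∈ Set.Ico (0 : ℤ) p, {y | InC x p a y}) :=
    (Set.finite_Ico _ _).isClosed_biUnion fun a _ => isClosed_inC x p a
  have hsub : orbitClosure x ⊆ ⋃ a ∈ Set.Ico (0 : ℤ) p, {y | InC x p a y} := by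
    apply closure_minimal _ hcl
    rintro _ ⟨n, rfl⟩
    rw [Set.mem_iUnion₂]
    refine ⟨n % p, ⟨Int.emod_nonneg _ hp'.ne', Int.emod_lt_of_pos _ hp'⟩, ?_⟩
    have := inC_shift (inC_self x p) n
    rw [zero_add] at this
    exact inC_emod this
  have := hsub hy
  rw [Set.mem_iUnion₂] at this
  obtain ⟨a, ha, h⟩ := this
  exact ⟨a, ha.1, ha.2, h⟩

theorem inC_x {A : Type} {x : ℤ → A} {p : ℕ} (hess : IsEssentialPeriod x p) {e : ℤ}
    (h : InC x p e x) : (p : ℤ) ∣ e := by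
  have hp := hess.1
  have := (ess_iff hp).1 hess (-e) (by
    apply stab_mk hp
    intro k hk
    have hv : x (k + -e) = x k := h k hk
    refine ⟨?_, hv⟩
    intro n
    have := h _ (perSet_add hk n)
    rw [hv, ← hk n, ← this]
    congr 1; ring)
  simpa using this

theorem mem_closure_orbit {A : Type} [TopologicalSpace A] [DiscreteTopology A] {x : ℤ → A}
    {p : ℕ → ℕ} (hps : IsPeriodStructure x p) {y : ℤ → A} (hy : y ∈ orbitClosure x) :
    x ∈ closure {w | ∃ n : ℤ, shiftZ n y = w} := by
  rw [mem_closure_seq]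
  intro M
  obtain ⟨l, _, hl⟩ := perSet_finset hps.2.2.1 hps.2.2.2 (Finset.Icc (-(M : ℤ)) M) 0
  obtain ⟨a, _, _, ha⟩ := exists_inC (hps.2.1 l).1 hy
  refine ⟨_, ⟨-a, rfl⟩, fun i h1 h2 => ?_⟩
  exact ha i (hl i (by simp [h1, h2]))

theorem inC_unique {A : Type} [TopologicalSpace A] [DiscreteTopology A] {x : ℤ → A}
    {p : ℕ → ℕ} (hps : IsPeriodStructure x p) {y : ℤ → A} (hy : y ∈ orbitClosure x)
    (l : ℕ) {a b : ℤ} (ha : InC x (p l) a y) (hb : InC x (p l) b y) :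
    (p l : ℤ) ∣ a - b := by
  have hp' : (0 : ℤ) < p l := by exact_mod_cast (hps.2.1 l).1
  have hcl : IsClosed (⋃ d ∈ Set.Ico (0 : ℤ) (p l),
      ({y | InC x (p l) (a + d) y} ∩ {y | InC x (p l) (b + d) y})) :=
    (Set.finite_Ico _ _).isClosed_biUnion fun d _ =>
      (isClosed_inC x _ _).inter (isClosed_inC x _ _)
  have hx := closure_minimal (s := {w | ∃ n : ℤ, shiftZ n y = w}) (by
    rintro _ ⟨n, rfl⟩
    rw [Set.mem_iUnion₂]
    refine ⟨n % p l, ⟨Int.emod_nonneg _ hp'.ne', Int.emod_lt_of_pos _ hp'⟩, ?_, ?_⟩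
    · refine inC_congr (inC_shift ha n) ?_
      rw [add_sub_add_left_eq_sub]; exact Int.dvd_self_sub_emod
    · refine inC_congr (inC_shift hb n) ?_
      rw [add_sub_add_left_eq_sub]; exact Int.dvd_self_sub_emod) hcl (mem_closure_orbit hps hy)
  rw [Set.mem_iUnion₂] at hx
  obtain ⟨d, _, h1, h2⟩ := hx
  have := dvd_sub (inC_x (hps.2.1 l) h1) (inC_x (hps.2.1 l) h2)
  rwa [add_sub_add_right_eq_sub] at this

/-! Complexity -/

/-- words of length `n` -/
def Words {A : Type} (X : Set (ℤ → A)) (n : ℕ) : Set (Fin n → A) :=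
  (fun w : ℤ → A => fun i : Fin n => w (i : ℕ)) '' X

theorem words_lt {A : Type} [Fintype A] [TopologicalSpace A] {x : ℤ → A} (hx : IsToeplitz x)
    (hnp : ¬ IsPeriodicSeq x) (n : ℕ) :
    (Words (orbitClosure x) n).ncard < (Words (orbitClosure x) (n + 1)).ncard := by
  by_contra hle
  push Not at hle
  let f : (Fin (n + 1) → A) → (Fin n → A) := fun w i => w i.castSucc
  have himg : f '' Words (orbitClosure x) (n + 1) = Words (orbitClosure x) n := by
    rw [Words, Set.image_image]; rfl
  have hinj : Set.InjOn f (Words (orbitClosure x) (n + 1)) := by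
    rw [← Set.ncard_image_iff (Set.toFinite _), himg]
    apply le_antisymm _ hle
    rw [← himg]
    exact Set.ncard_image_le (Set.toFinite _)
  obtain ⟨i, j, hij, heq⟩ : ∃ i j : ℕ, i < j ∧
      (fun m : Fin n => x (i + (m : ℕ))) = (fun m : Fin n => x (j + (m : ℕ))) := by
    obtain ⟨i, j, hij, h⟩ := Finite.exists_ne_map_eq_of_infinite
      (fun i : ℕ => (fun m : Fin n => x (i + (m : ℕ))))
    rcases lt_or_gt_of_ne hij with h' | h'
    · exact ⟨i, j, h', h⟩
    · exact ⟨j, i, h', h.symm⟩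
  have hstep : ∀ a b : ℤ, (∀ m : ℕ, m < n → x (a + m) = x (b + m)) →
      (∀ m : ℕ, m < n + 1 → x (a + m) = x (b + m)) := by
    intro a b hab m hm
    have hmem : ∀ a : ℤ, (fun m : Fin (n + 1) => x (a + (m : ℕ))) ∈
        Words (orbitClosure x) (n + 1) := by
      intro a
      refine ⟨shiftZ a x, shiftZ_self_mem x a, ?_⟩
      funext m; simp [shiftZ, add_comm]
    have := hinj (hmem a) (hmem b) (by
      funext m
      exact hab m m.2)
    exact congrFun this ⟨m, hm⟩
  have hall : ∀ k : ℕ, ∀ m : ℕ, m < n → x ((i + k : ℤ) + m) = x ((j + k : ℤ) + m) := by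
    intro k
    induction k with
    | zero =>
      intro m hm
      simpa using congrFun heq ⟨m, hm⟩
    | succ k ih =>
      intro m hm
      have := hstep _ _ ih (m + 1) (by omega)
      push_cast at this ⊢
      convert this using 2 <;> ring
  have hall' : ∀ k : ℕ, x (i + k) = x (j + k) := by
    intro k
    simpa using hstep _ _ (hall k) 0 (by omega)
  apply hnp
  refine ⟨j - i, by omega, fun m => ?_⟩
  obtain ⟨p, hp, hpm⟩ := hx m
  obtain ⟨q, hq, hqm⟩ := hx (m + (j - i : ℕ))
  have hK : ∃ K : ℕ, (i : ℤ) ≤ m + (K * q : ℤ) * p := by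
    refine ⟨(i - m).toNat, ?_⟩
    have h1 : (1 : ℤ) ≤ q * p := by exact_mod_cast Nat.mul_pos hq hp
    have h2 : (i : ℤ) - m ≤ (i - m).toNat := Int.self_le_toNat _
    have h3 : (0 : ℤ) ≤ ((i - m : ℤ).toNat : ℤ) := by positivity
    nlinarith
  obtain ⟨K, hK⟩ := hK
  obtain ⟨k, hk⟩ := Int.eq_ofNat_of_zero_le (sub_nonneg.2 hK)
  have h1 := hpm (K * q)
  have h2 := hqm (K * p)
  have h3 := hall' k
  rw [← h1, ← h2]
  have e1 : (i : ℤ) + k = m + (K * q : ℤ) * p := by rw [← hk]; ring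
  rw [← e1, h3]
  congr 1
  push_cast [hij.le]
  linear_combination -e1

theorem words_mono {A : Type} [Fintype A] [TopologicalSpace A] {x : ℤ → A} (hx : IsToeplitz x)
    (hnp : ¬ IsPeriodicSeq x) : StrictMono fun n => (Words (orbitClosure x) n).ncard :=
  strictMono_nat_of_lt_succ (words_lt hx hnp)

theorem finite_dep {A D : Type} [Fintype A] [TopologicalSpace A] [DiscreteTopology A]
    [TopologicalSpace D] [DiscreteTopology D] (X : Set (ℤ → A)) (hX : IsClosed X)
    (F : X → D) (hF : Continuous F) :
    ∃ R : ℕ, ∀ w w' : X, (∀ i : ℤ, -(R : ℤ) ≤ i → i ≤ R → w.1 i = w'.1 i) → F w = F w' := by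
  by_contra hcon
  push Not at hcon
  have : CompactSpace X := isCompact_iff_compactSpace.1 hX.isCompact
  let K : ℕ → Set (X × X) := fun R =>
    {w | (∀ i : ℤ, -(R : ℤ) ≤ i → i ≤ R → w.1.1 i = w.2.1 i) ∧ F w.1 ≠ F w.2}
  have hcl : ∀ R, IsClosed (K R) := by
    intro R
    refine IsClosed.inter (s₁ := {w : X × X | ∀ i : ℤ, -(R : ℤ) ≤ i → i ≤ R → w.1.1 i = w.2.1 i})
      (s₂ := {w : X × X | F w.1 ≠ F w.2}) ?_ ?_
    · simp only [Set.ofPred_forall]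
      refine isClosed_iInter fun i => isClosed_iInter fun _ => isClosed_iInter fun _ => ?_
      exact isClosed_eq ((continuous_apply i).comp (continuous_subtype_val.comp continuous_fst))
        ((continuous_apply i).comp (continuous_subtype_val.comp continuous_snd))
    · have : Continuous fun w : X × X => (F w.1, F w.2) := by fun_prop
      exact (isClosed_discrete {d : D × D | d.1 ≠ d.2}).preimage this
  obtain ⟨w, hw⟩ := IsCompact.nonempty_iInter_of_sequence_nonempty_isCompact_isClosed K
    (by
      intro R w hw
      refine ⟨fun i h1 h2 => hw.1 i (by push_cast; omega) (by push_cast; omega), hw.2⟩)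
    (by
      intro R
      obtain ⟨w, w', h1, h2⟩ := hcon R
      exact ⟨(w, w'), h1, h2⟩)
    (hcl 0).isCompact hcl
  rw [Set.mem_iInter] at hw
  apply (hw 0).2
  congr 1
  apply Subtype.ext
  funext i
  exact (hw i.natAbs).1 i (by omega) (by omega)

/-! The time change `φ`. -/

/-- `φ(qP + j) = cPq + j`. -/
def tc (c P : ℕ) (n : ℤ) : ℤ := c * P * (n / P) + n % P

theorem tc_small {c P : ℕ} {n : ℤ} (h0 : 0 ≤ n) (h1 : n < P) : tc c P n = n := by
  simp [tc, Int.ediv_eq_zero_of_lt h0 h1, Int.emod_eq_of_lt h0 h1]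

theorem tc_add {c P : ℕ} (hP : 0 < P) (n m : ℤ) :
    tc c P (n + m * P) = tc c P n + c * (m * P) := by
  have hP' : (P : ℤ) ≠ 0 := by exact_mod_cast hP.ne'
  simp only [tc]
  rw [Int.add_mul_ediv_right _ _ hP', Int.add_mul_emod_self_right]
  ring

theorem tc_add_dvd {c P : ℕ} (hP : 0 < P) (n : ℤ) {t : ℤ} (ht : (P : ℤ) ∣ t) :
    tc c P (n + t) = tc c P n + c * t := by
  obtain ⟨m, rfl⟩ := ht
  rw [mul_comm (P : ℤ) m, tc_add hP]

theorem tc_emod (c P : ℕ) (n : ℤ) : tc c P n % P = n % P := by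
  have : tc c P n = n % P + P * (c * (n / P)) := by simp only [tc]; ring
  rw [this, Int.add_mul_emod_self_left, Int.emod_emod]

theorem tc_surj {c P : ℕ} (hP : 0 < P) (hc : 0 < c) (k : ℤ) :
    ∃ (m : ℤ) (i : Fin (c * P)), k = tc c P m + (i : ℕ) := by
  have hcP : 0 < c * P := Nat.mul_pos hc hP
  have hcP' : (0 : ℤ) < (c * P : ℕ) := by exact_mod_cast hcP
  have h0 := Int.emod_nonneg k hcP'.ne'
  have h1 := Int.emod_lt_of_pos k hcP'
  refine ⟨k / (c * P : ℕ) * P, ⟨(k % (c * P : ℕ)).toNat, by omega⟩, ?_⟩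
  have h2 := tc_add (c := c) hP 0 (k / (c * P : ℕ))
  rw [zero_add, tc_small le_rfl (by exact_mod_cast hP)] at h2
  rw [h2]
  simp only [Int.toNat_of_nonneg h0]
  have := Int.emod_add_mul_ediv k (c * P : ℕ)
  push_cast at this ⊢
  linear_combination -this

theorem tc_diff {c P : ℕ} (hP : 0 < P) (n : ℤ) :
    tc c P (n + 1) - tc c P n = tc c P (n % P + 1) - n % P := by
  have hP' : (0 : ℤ) < P := by exact_mod_cast hP
  have h := Int.emod_add_mul_ediv n P
  have h0 := Int.emod_nonneg n hP'.ne'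
  have h1 := Int.emod_lt_of_pos n hP'
  have e1 : n + 1 = (n % P + 1) + (n / P) * P := by linear_combination -h
  rw [e1, tc_add hP]
  have e2 : tc c P n = n % P + c * (n / P * P) := by simp only [tc]; ring
  rw [e2]; ring

theorem tc_hit {c P Q : ℕ} (hP : 0 < P) (hQ : 0 < Q) (hPQ : P ∣ Q) (hc : Nat.Coprime c (Q / P))
    (t : ℤ) (b : ℤ) : ∃ m : ℤ, b ≤ m ∧ (Q : ℤ) ∣ tc c P m - t := by
  obtain ⟨d, rfl⟩ := hPQ
  rw [Nat.mul_div_cancel_left _ hP] at hc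
  have hd : 0 < d := Nat.pos_of_mul_pos_left hQ
  have hP' : (0 : ℤ) < P := by exact_mod_cast hP
  have hd' : (0 : ℤ) < d := by exact_mod_cast hd
  obtain ⟨u, v, huv⟩ := Int.isCoprime_iff_gcd_eq_one.2 (show Int.gcd (c : ℤ) d = 1 by simpa using hc)
  have h0 := Int.emod_nonneg t hP'.ne'
  have h1 := Int.emod_lt_of_pos t hP'
  have hdiv := Int.emod_add_mul_ediv t P
  let q : ℤ := u * (t / P) + d * (|b| + |u * (t / P)|)
  refine ⟨t % P + q * P, ?_, ?_⟩
  · have h2 := neg_abs_le (u * (t / P))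
    have h3 := abs_nonneg b
    have h3' := abs_nonneg (u * (t / P))
    have h4 := le_abs_self b
    have h5 : |b| + |u * (t / P)| ≤ d * (|b| + |u * (t / P)|) :=
      le_mul_of_one_le_left (by omega) (by omega)
    have h6 : |b| ≤ q := by simp only [q]; omega
    have h7 : q ≤ q * P := le_mul_of_one_le_right (by omega) (by omega)
    omega
  · rw [tc_add hP, tc_small h0 h1]
    refine ⟨c * (|b| + |u * (t / P)|) - v * (t / P), ?_⟩
    simp only [q]
    push_cast
    linear_combination hdiv + (t / P) * P * huv

/-- residue of `y` in `ℤ/P`. -/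
def res {A : Type} (x : ℤ → A) (P : ℕ) (y : ℤ → A) : ℤ :=
  if h : ∃ a : ℤ, 0 ≤ a ∧ a < P ∧ InC x P a y then h.choose else 0

/-- the speedup function -/
def spd {A : Type} (x : ℤ → A) (P c : ℕ) (y : ℤ → A) : ℕ :=
  if res x P y = P - 1 then 1 + (c - 1) * P else 1

/-- the speedup -/
def SP {A : Type} (x : ℤ → A) (P c : ℕ) (y : ℤ → A) : ℤ → A := shiftMap^[spd x P c y] y

section Main

set_option linter.unusedSectionVars false

variable {A : Type} [TopologicalSpace A] [DiscreteTopology A] {x : ℤ → A} {p : ℕ → ℕ} {N c : ℕ}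

theorem res_spec (hps : IsPeriodStructure x p) {y : ℤ → A} (hy : y ∈ orbitClosure x) :
    0 ≤ res x (p N) y ∧ res x (p N) y < p N ∧ InC x (p N) (res x (p N) y) y := by
  have h := exists_inC (hps.2.1 N).1 hy
  rw [res, dif_pos h]
  exact h.choose_spec

theorem res_eq (hps : IsPeriodStructure x p) {y : ℤ → A} (hy : y ∈ orbitClosure x) {a : ℤ}
    (ha : InC x (p N) a y) : res x (p N) y = a % p N := by
  obtain ⟨h0, h1, h2⟩ := res_spec (N := N) hps hy
  have := inC_unique hps hy N h2 ha
  rw [← Int.emod_eq_of_lt h0 h1]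
  exact Int.emod_eq_emod_iff_emod_sub_eq_zero.2 (Int.emod_eq_zero_of_dvd this)

theorem res_shift (hps : IsPeriodStructure x p) {y : ℤ → A} (hy : y ∈ orbitClosure x) (n : ℤ) :
    res x (p N) (shiftZ n y) = (res x (p N) y + n) % p N :=
  res_eq hps (shiftZ_mem n hy) (inC_shift (res_spec hps hy).2.2 n)

theorem res_x (hps : IsPeriodStructure x p) : res x (p N) x = 0 := by
  rw [res_eq hps (self_mem x) (inC_self x _)]; simp

theorem spd_eq (hps : IsPeriodStructure x p) (hc : 2 ≤ c) {y : ℤ → A} (hy : y ∈ orbitClosure x) :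
    (spd x (p N) c y : ℤ) = tc c (p N) (res x (p N) y + 1) - res x (p N) y := by
  obtain ⟨h0, h1, _⟩ := res_spec (N := N) hps hy
  have hP := (hps.2.1 N).1
  unfold spd
  split_ifs with h
  · have : res x (p N) y + 1 = 0 + 1 * (p N : ℤ) := by rw [h]; ring
    rw [this, tc_add hP, tc_small le_rfl (by exact_mod_cast hP), h]
    push_cast [show 1 ≤ c by omega]
    ring
  · rw [tc_small (by omega) (by omega)]; push_cast; ring

theorem SP_eq (hps : IsPeriodStructure x p) (hc : 2 ≤ c) {y : ℤ → A} (hy : y ∈ orbitClosure x) :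
    SP x (p N) c y = shiftZ (tc c (p N) (res x (p N) y + 1) - res x (p N) y) y := by
  rw [SP, shiftMap_iter, spd_eq hps hc hy]

theorem SP_tc (hps : IsPeriodStructure x p) (hc : 2 ≤ c) {y : ℤ → A} (hy : y ∈ orbitClosure x)
    (n : ℤ) : SP x (p N) c (shiftZ (tc c (p N) n - res x (p N) y) y) =
      shiftZ (tc c (p N) (n + 1) - res x (p N) y) y := by
  rw [SP_eq hps hc (shiftZ_mem _ hy), res_shift hps hy, shiftZ_add, add_sub_cancel, tc_emod,
    ← tc_diff (hps.2.1 N).1]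
  congr 1; ring

theorem SP_iter (hps : IsPeriodStructure x p) (hc : 2 ≤ c) {y : ℤ → A} (hy : y ∈ orbitClosure x)
    (n : ℤ) (k : ℕ) : (SP x (p N) c)^[k] (shiftZ (tc c (p N) n - res x (p N) y) y) =
      shiftZ (tc c (p N) (n + k) - res x (p N) y) y := by
  induction k with
  | zero => simp
  | succ k ih =>
    rw [Function.iterate_succ_apply', ih, SP_tc hps hc hy]
    push_cast; rw [add_assoc]

theorem SP_iter_self (hps : IsPeriodStructure x p) (hc : 2 ≤ c) {y : ℤ → A}
    (hy : y ∈ orbitClosure x) (k : ℕ) : (SP x (p N) c)^[k] y =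
      shiftZ (tc c (p N) (res x (p N) y + k) - res x (p N) y) y := by
  obtain ⟨h0, h1, _⟩ := res_spec (N := N) hps hy
  rw [← SP_iter hps hc hy, tc_small h0 h1, sub_self, shiftZ_zero]

theorem SP_iter_P (hps : IsPeriodStructure x p) (hc : 2 ≤ c) {y : ℤ → A}
    (hy : y ∈ orbitClosure x) : (SP x (p N) c)^[p N] y = shiftZ (c * p N) y := by
  obtain ⟨h0, h1, _⟩ := res_spec (N := N) hps hy
  rw [SP_iter_self hps hc hy, tc_add_dvd (hps.2.1 N).1 _ dvd_rfl, tc_small h0 h1]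
  congr 1; ring

theorem SP_mem {y : ℤ → A} (P : ℕ) (hy : y ∈ orbitClosure x) : SP x P c y ∈ orbitClosure x := by
  rw [SP, shiftMap_iter]; exact shiftZ_mem _ hy

theorem p_dvd (hps : IsPeriodStructure x p) {a b : ℕ} (hab : a ≤ b) : p a ∣ p b := by
  induction hab with
  | refl => exact dvd_rfl
  | step _ ih => exact ih.trans (hps.2.2.1 _)

theorem p_coprime (hps : IsPeriodStructure x p)
    (hgcd : ∀ k, N ≤ k → Nat.gcd c (p (k + 1) / p k) = 1) {k : ℕ} (hk : N ≤ k) :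
    Nat.Coprime c (p k / p N) := by
  induction k, hk using Nat.le_induction with
  | base => rw [Nat.div_self (hps.2.1 N).1]; exact Nat.coprime_one_right c
  | succ k hk ih =>
    have e : p (k + 1) / p N = p (k + 1) / p k * (p k / p N) := by
      apply Nat.div_eq_of_eq_mul_left (hps.2.1 N).1
      rw [mul_assoc, Nat.div_mul_cancel (p_dvd hps hk), Nat.div_mul_cancel (hps.2.2.1 k)]
    rw [e]
    exact Nat.Coprime.mul_right (hgcd k hk) ih

theorem SP_dense (hps : IsPeriodStructure x p) (hc : 2 ≤ c)
    (hgcd : ∀ k, N ≤ k → Nat.gcd c (p (k + 1) / p k) = 1) {y : ℤ → A}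
    (hy : y ∈ orbitClosure x) :
    orbitClosure x ⊆ closure {v | ∃ k : ℕ, (SP x (p N) c)^[k] y = v} := by
  apply closure_minimal _ isClosed_closure
  rintro _ ⟨n, rfl⟩
  rw [mem_closure_seq]
  intro M
  obtain ⟨l, hNl, hl⟩ := perSet_finset hps.2.2.1 hps.2.2.2
    (Finset.Icc (n - (M : ℤ)) (n + M)) N
  obtain ⟨a, _, _, ha⟩ := exists_inC (hps.2.1 l).1 hy
  obtain ⟨m, hm, hd⟩ := tc_hit (hps.2.1 N).1 (hps.2.1 l).1 (p_dvd hps hNl)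
    (p_coprime hps hgcd hNl) (n - a + res x (p N) y) (res x (p N) y)
  refine ⟨_, ⟨(m - res x (p N) y).toNat, rfl⟩, fun i h1 h2 => ?_⟩
  rw [SP_iter_self hps hc hy, Int.toNat_of_nonneg (by omega), add_sub_cancel]
  have hin : n + i ∈ PerSet x (p l) := hl _ (by rw [Finset.mem_Icc]; omega)
  have h3 := ha _ (perSet_add_dvd hin hd)
  rw [perSet_val hin hd] at h3
  simp only [shiftZ]
  rw [add_comm i n, ← h3]
  congr 1; ring

theorem shift_free (hps : IsPeriodStructure x p) {y : ℤ → A} (hy : y ∈ orbitClosure x)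
    {a b : ℤ} (h : shiftZ a y = shiftZ b y) : a = b := by
  let l := (a - b).natAbs + 1
  obtain ⟨e, _, _, he⟩ := exists_inC (hps.2.1 l).1 hy
  have h1 := inC_shift he a
  have h2 := inC_shift he b
  rw [← h] at h2
  have h3 := inC_unique hps (shiftZ_mem a hy) l h1 h2
  rw [add_sub_add_left_eq_sub] at h3
  by_contra hne
  have h4 : p l ∣ (a - b).natAbs := by simpa using Int.natAbs_dvd_natAbs.2 h3
  have h5 := Nat.le_of_dvd (by omega) h4
  have h6 : l ≤ p l := hps.1.id_le l
  omega

theorem mem_orbitIn_shift {y w : ℤ → A} :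
    w ∈ orbitIn shiftMap (orbitClosure x) y ↔
      w ∈ orbitClosure x ∧ ∃ s : ℤ, w = shiftZ s y := by
  refine and_congr_right fun _ => ?_
  constructor
  · rintro ⟨n, h | h⟩
    · exact ⟨n, by rw [← h, shiftMap_iter]⟩
    · refine ⟨-n, ?_⟩
      rw [← h, shiftMap_iter, shiftZ_add]; simp [shiftZ_zero]
  · rintro ⟨s, rfl⟩
    refine ⟨s.natAbs, ?_⟩
    rw [shiftMap_iter, shiftMap_iter, shiftZ_add]
    rcases Int.natAbs_eq s with h | h
    · left; rw [← h]
    · right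
      have : (s.natAbs : ℤ) + s = 0 := by omega
      rw [this, shiftZ_zero]

theorem SP_minimal (hps : IsPeriodStructure x p) (hc : 2 ≤ c)
    (hgcd : ∀ k, N ≤ k → Nat.gcd c (p (k + 1) / p k) = 1) :
    MinimalOn (SP x (p N) c) (orbitClosure x) := by
  intro y hy
  refine (SP_dense hps hc hgcd hy).trans (closure_mono ?_)
  rintro _ ⟨k, rfl⟩
  refine ⟨?_, k, Or.inl rfl⟩
  rw [SP_iter_self hps hc hy]
  exact shiftZ_mem _ hy

theorem SP_orbitNumber (hps : IsPeriodStructure x p) (hc : 2 ≤ c) :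
    OrbitNumberOn shiftMap (SP x (p N) c) (orbitClosure x) c := by
  intro y hy
  have hP := (hps.2.1 N).1
  have hP' : (0 : ℤ) < p N := by exact_mod_cast hP
  have hc' : (0 : ℤ) < c := by omega
  let r : Fin c → (ℤ → A) := fun i => shiftZ (p N * (i : ℕ) - res x (p N) y) y
  have hr : ∀ i, r i ∈ orbitClosure x := fun i => shiftZ_mem _ hy
  have hres : ∀ i, res x (p N) (r i) = 0 := by
    intro i
    rw [res_shift hps hy, add_sub_cancel]; simp
  have hit : ∀ i (n : ℤ) (k : ℕ), (SP x (p N) c)^[k] (shiftZ (tc c (p N) n) (r i)) =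
      shiftZ (tc c (p N) (n + k)) (r i) := by
    intro i n k
    have := SP_iter (N := N) hps hc (hr i) n k
    simpa [hres i] using this
  have htc0 : tc c (p N) 0 = 0 := tc_small le_rfl hP'
  have hit0 : ∀ i (k : ℕ), (SP x (p N) c)^[k] (r i) = shiftZ (tc c (p N) k) (r i) := by
    intro i k
    have := hit i 0 k
    rwa [htc0, shiftZ_zero, zero_add] at this
  have hdist : ∀ (i j : Fin c) (n : ℕ), (SP x (p N) c)^[n] (r i) = r j → i = j := by
    intro i j n h
    rw [hit0, shiftZ_add] at h
    have h1 := shift_free hps hy h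
    have h2 : (n : ℤ) % p N = 0 := by
      rw [← tc_emod c]
      have : tc c (p N) n = p N * ((j : ℕ) - (i : ℕ)) := by linear_combination h1
      rw [this]; simp
    have h3 : (c : ℤ) * (n / p N) + (i : ℕ) = (j : ℕ) := by
      simp only [tc, h2] at h1
      have : (p N : ℤ) * (c * (n / p N) + (i : ℕ)) = p N * (j : ℕ) := by linear_combination h1
      exact mul_left_cancel₀ hP'.ne' this
    have h4 : ((i : ℕ) : ℤ) % c = ((j : ℕ) : ℤ) % c := by
      rw [← h3, add_comm, Int.add_mul_emod_self_left]
    rw [Int.emod_eq_of_lt (by omega) (by omega), Int.emod_eq_of_lt (by omega) (by omega)] at h4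
    apply Fin.ext
    exact_mod_cast h4
  refine ⟨r, fun i => ?_, ?_, ?_⟩
  · exact mem_orbitIn_shift.2 ⟨hr i, _, rfl⟩
  · rintro i j hij ⟨_, n, h | h⟩
    · exact hij (hdist i j n h)
    · exact hij (hdist j i n h).symm
  · intro w hw
    obtain ⟨hwX, s, rfl⟩ := mem_orbitIn_shift.1 hw
    let u := s + res x (p N) y
    have hu := Int.emod_add_mul_ediv u (p N)
    have hq := Int.emod_add_mul_ediv (u / p N) c
    have h0 := Int.emod_nonneg (u / p N) hc'.ne'
    have h1 := Int.emod_lt_of_pos (u / p N) hc'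
    let i : Fin c := ⟨(u / p N % c).toNat, by omega⟩
    have hi : ((i : ℕ) : ℤ) = u / p N % c := Int.toNat_of_nonneg h0
    let n : ℤ := u % p N + u / p N / c * p N
    have htn : tc c (p N) n = u % p N + c * (u / p N / c * p N) := by
      rw [tc_add hP, tc_small (Int.emod_nonneg _ hP'.ne') (Int.emod_lt_of_pos _ hP')]
    have hs : shiftZ s y = shiftZ (tc c (p N) n) (r i) := by
      rw [shiftZ_add, htn, hi]
      congr 1
      have : s = u - res x (p N) y := by simp [u]
      linear_combination this - hu - p N * hq
    refine ⟨i, hwX, n.natAbs, ?_⟩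
    rcases Int.natAbs_eq n with h | h
    · left
      rw [hit0, ← h, hs]
    · right
      rw [hs, hit]
      have : n + n.natAbs = 0 := by omega
      rw [this, htc0, shiftZ_zero]

theorem res_continuous (hps : IsPeriodStructure x p) :
    Continuous fun y : orbitClosure x => res x (p N) y.1 := by
  rw [continuous_iff_isClosed]
  intro s _
  have : (fun y : orbitClosure x => res x (p N) y.1) ⁻¹' s =
      ⋃ a ∈ (Set.Ico (0 : ℤ) (p N) ∩ s), Subtype.val ⁻¹' {y | InC x (p N) a y} := by
    ext y
    rw [Set.mem_iUnion₂]
    obtain ⟨h0, h1, h2⟩ := res_spec (N := N) hps y.2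
    constructor
    · intro h
      exact ⟨_, ⟨⟨h0, h1⟩, h⟩, h2⟩
    · rintro ⟨a, ⟨ha, has⟩, h⟩
      have := res_eq hps y.2 h
      rw [Int.emod_eq_of_lt ha.1 ha.2] at this
      simpa [this] using has
  rw [this]
  exact ((Set.finite_Ico _ _).inter_of_left _).isClosed_biUnion fun a _ =>
    (isClosed_inC x _ a).preimage continuous_subtype_val

theorem eval_continuous {Y : Type} [TopologicalSpace Y] {f : Y → (ℤ → A)} {g : Y → ℤ}
    (hf : Continuous f) (hg : Continuous g) : Continuous fun y => f y (g y) := by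
  have : Continuous fun q : (ℤ → A) × ℤ => q.1 q.2 := by
    rw [continuous_prod_of_discrete_right]
    intro b
    exact continuous_apply b
  exact this.comp (hf.prodMk hg)

theorem spd_continuous (hps : IsPeriodStructure x p) :
    ContinuousOn (spd x (p N) c) (orbitClosure x) := by
  rw [continuousOn_iff_continuous_domRestrict]
  have h : Continuous fun a : ℤ => if a = p N - 1 then 1 + (c - 1) * p N else 1 :=
    continuous_of_discreteTopology
  exact h.comp (res_continuous hps)

theorem SP_continuous (hps : IsPeriodStructure x p) :
    Continuous fun y : orbitClosure x => SP x (p N) c y.1 := by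
  simp only [SP, shiftMap_iter]
  have h := continuousOn_iff_continuous_domRestrict.1 (spd_continuous (N := N) (c := c) hps)
  apply continuous_pi
  intro k
  apply eval_continuous continuous_subtype_val
  have h2 : Continuous fun a : ℕ => k + (a : ℤ) := continuous_of_discreteTopology
  exact h2.comp h

theorem SP_homeo [Fintype A] (hps : IsPeriodStructure x p) (hc : 2 ≤ c) :
    RestrictsToHomeomorph (SP x (p N) c) (orbitClosure x) := by
  have hP := (hps.2.1 N).1
  have hP' : (0 : ℤ) < p N := by exact_mod_cast hP
  have : CompactSpace (orbitClosure x) :=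
    isCompact_iff_compactSpace.1 (isClosed_closure (s := {y | ∃ n : ℤ, shiftZ n x = y})).isCompact
  let S : orbitClosure x → orbitClosure x := fun y => ⟨SP x (p N) c y.1, SP_mem _ y.2⟩
  have hcont : Continuous S := (SP_continuous hps).subtype_mk _
  have hinj : Function.Injective S := by
    intro y w h
    have h' : SP x (p N) c y.1 = SP x (p N) c w.1 := congrArg Subtype.val h
    obtain ⟨a0, a1, _⟩ := res_spec (N := N) hps y.2
    obtain ⟨b0, b1, _⟩ := res_spec (N := N) hps w.2
    rw [SP_eq hps hc y.2, SP_eq hps hc w.2] at h'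
    have hr := congrArg (res x (p N)) h'
    rw [res_shift hps y.2, res_shift hps w.2, add_sub_cancel, add_sub_cancel, tc_emod, tc_emod]
      at hr
    have hr2 : res x (p N) y.1 = res x (p N) w.1 := by
      have h1 := Int.ModEq.add_right_cancel' 1 (show _ ≡ _ [ZMOD p N] from hr)
      have h2 : res x (p N) y.1 % p N = res x (p N) w.1 % p N := h1
      rwa [Int.emod_eq_of_lt a0 a1, Int.emod_eq_of_lt b0 b1] at h2
    rw [hr2] at h'
    have := congrArg (shiftZ (-(tc c (p N) (res x (p N) w.1 + 1) - res x (p N) w.1))) h'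
    rw [shiftZ_add, shiftZ_add, neg_add_cancel, shiftZ_zero, shiftZ_zero] at this
    exact Subtype.ext this
  have hsurj : Function.Surjective S := by
    intro w
    obtain ⟨b0, b1, _⟩ := res_spec (N := N) hps w.2
    refine ⟨⟨shiftZ (tc c (p N) (res x (p N) w.1 - 1) - res x (p N) w.1) w.1,
      shiftZ_mem _ w.2⟩, ?_⟩
    apply Subtype.ext
    have := SP_tc (N := N) hps hc w.2 (res x (p N) w.1 - 1)
    rw [sub_add_cancel, tc_small b0 b1, sub_self, shiftZ_zero] at this
    exact this
  exact ⟨Continuous.homeoOfEquivCompactToT2 (f := Equiv.ofBijective S ⟨hinj, hsurj⟩) hcont,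
    fun y => rfl⟩

theorem SP_not_conj [Fintype A] (hx : IsToeplitz x) (hnp : ¬ IsPeriodicSeq x)
    (hps : IsPeriodStructure x p) (hc : 2 ≤ c) :
    ¬ TopConj (orbitClosure x) (SP x (p N) c) (orbitClosure x) shiftMap := by
  rintro ⟨hS, hR, h, heq⟩
  have hP := (hps.2.1 N).1
  have hcl : IsClosed (orbitClosure x) := isClosed_closure
  have hiter : ∀ (k : ℕ) (w : orbitClosure x),
      (h.symm ⟨shiftZ k w.1, shiftZ_mem _ w.2⟩).1 = (SP x (p N) c)^[k] (h.symm w).1 := by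
    intro k w
    induction k with
    | zero => simp [shiftZ_zero]
    | succ k ih =>
      rw [Function.iterate_succ_apply', ← ih]
      have h1 := heq (h.symm ⟨shiftZ k w.1, shiftZ_mem _ w.2⟩)
      rw [h.apply_symm_apply] at h1
      have h2 := congrArg h.symm h1
      rw [h.symm_apply_apply] at h2
      have h3 := congrArg Subtype.val h2
      rw [Set.MapsTo.val_restrict_apply] at h3
      rw [h3]
      congr 2
      apply Subtype.ext
      rw [Set.MapsTo.val_restrict_apply]
      change shiftZ ((k + 1 : ℕ) : ℤ) w.1 = shiftMap (shiftZ k w.1)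
      rw [← shiftMap_iter, ← shiftMap_iter, Function.iterate_succ_apply']
  have hiterP : ∀ (m : ℕ) (w : orbitClosure x),
      (h.symm ⟨shiftZ ((p N * m : ℕ) : ℤ) w.1, shiftZ_mem _ w.2⟩).1 =
        shiftZ (c * p N * m) (h.symm w).1 := by
    intro m w
    rw [hiter, Function.iterate_mul]
    induction m with
    | zero => simp [shiftZ_zero]
    | succ m ih =>
      rw [Function.iterate_succ_apply', ih, SP_iter_P hps hc (shiftZ_mem _ (h.symm w).2),
        shiftZ_add]
      congr 1; push_cast; ring
  obtain ⟨R, hR⟩ := finite_dep (orbitClosure x) hcl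
    (fun w => fun i : Fin (c * p N) => (h.symm w).1 (i : ℕ)) (by
      apply continuous_pi
      intro i
      exact (continuous_apply _).comp (continuous_subtype_val.comp h.symm.continuous))
  -- the counting inequality
  have hcount : ∀ m : ℕ, (Words (orbitClosure x) (c * p N * m)).ncard ≤
      (Words (orbitClosure x) (p N * m + 2 * R + 1)).ncard := by
    intro m
    have hsel : ∀ v ∈ Words (orbitClosure x) (c * p N * m), ∃ w : orbitClosure x,
        (fun i : Fin (c * p N * m) => (h.symm w).1 (i : ℕ)) = v := by
      rintro _ ⟨y, hy, rfl⟩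
      refine ⟨h ⟨y, hy⟩, ?_⟩
      rw [h.symm_apply_apply]
    have : Nonempty (orbitClosure x) := ⟨⟨x, self_mem x⟩⟩
    choose! g hg using hsel
    refine Set.ncard_le_ncard_of_injOn
      (fun v => fun i : Fin (p N * m + 2 * R + 1) => (g v).1 ((i : ℕ) - R)) ?_ ?_ (Set.toFinite _)
    · intro v hv
      refine ⟨shiftZ (-R) (g v).1, shiftZ_mem _ (g v).2, ?_⟩
      rfl
    · intro v hv v' hv' hvv
      rw [← hg v hv, ← hg v' hv']
      have hag : ∀ j : ℤ, -(R : ℤ) ≤ j → j ≤ p N * m + R → (g v).1 j = (g v').1 j := by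
        intro j h1 h2
        have h3 := congrFun hvv ⟨(j + R).toNat, by
          zify
          rw [Int.toNat_of_nonneg (by omega)]
          omega⟩
        simpa [Int.toNat_of_nonneg (show 0 ≤ j + R by omega)] using h3
      funext i
      have hcP : 0 < c * p N := Nat.mul_pos (by omega) hP
      have hi := Nat.mod_add_div (i : ℕ) (c * p N)
      have hi1 := Nat.mod_lt (i : ℕ) hcP
      have hi2 : (i : ℕ) / (c * p N) < m := Nat.div_lt_of_lt_mul i.2
      set q := (i : ℕ) / (c * p N) with hqdef
      have hle : p N * q ≤ p N * m := Nat.mul_le_mul_left _ hi2.le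
      have key := hR ⟨shiftZ ((p N * q : ℕ) : ℤ) (g v).1, shiftZ_mem _ (g v).2⟩
        ⟨shiftZ ((p N * q : ℕ) : ℤ) (g v').1, shiftZ_mem _ (g v').2⟩ (by
          intro j h1 h2
          apply hag
          · have : (0 : ℤ) ≤ ((p N * q : ℕ) : ℤ) := Int.natCast_nonneg _
            omega
          · zify at hle; push_cast; omega)
      have key2 := congrFun key ⟨(i : ℕ) % (c * p N), hi1⟩
      simp only [hiterP] at key2
      simp only [shiftZ] at key2
      convert key2 using 2
      · push_cast; zify at hi; linear_combination -hi
      · push_cast; zify at hi; linear_combination -hi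
  have h1 := (words_mono hx hnp).le_iff_le.1 (hcount (2 * R + 2))
  have h2 : 2 * (p N * (2 * R + 2)) ≤ c * (p N * (2 * R + 2)) := Nat.mul_le_mul_right _ hc
  have h3 : 1 * (2 * R + 2) ≤ p N * (2 * R + 2) := Nat.mul_le_mul_right _ hP
  rw [mul_assoc] at h1
  omega

/-- the coding of `(X,S)` -/
def code (x : ℤ → A) (P c : ℕ) (hP : 0 < P) (w : ℤ → A) : ℤ → Fin P × (Fin (c * P) → A) :=
  fun n => (⟨((res x P w + n) % P).toNat, by
      have hP' : (0 : ℤ) < P := by exact_mod_cast hP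
      have h0 := Int.emod_nonneg (res x P w + n) hP'.ne'
      have h1 := Int.emod_lt_of_pos (res x P w + n) hP'
      omega⟩,
    fun i => w (tc c P (res x P w + n) - res x P w + (i : ℕ)))

theorem code_eq_iff (P : ℕ) (hP : 0 < P) (w w' : ℤ → A) (n n' : ℤ) :
    code x P c hP w n = code x P c hP w' n' ↔
      ((res x P w + n) % P = (res x P w' + n') % P ∧ ∀ i : Fin (c * P),
        w (tc c P (res x P w + n) - res x P w + (i : ℕ)) =
          w' (tc c P (res x P w' + n') - res x P w' + (i : ℕ))) := by
  have hP' : (0 : ℤ) < P := by exact_mod_cast hP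
  have h0 := Int.emod_nonneg (res x P w + n) hP'.ne'
  have h1 := Int.emod_nonneg (res x P w' + n') hP'.ne'
  simp only [code, Prod.mk.injEq, Fin.mk.injEq, funext_iff]
  refine and_congr_left fun _ => ?_
  omega

/-- `code` along the orbit. -/
theorem code_shift (hps : IsPeriodStructure x p) {w : ℤ → A}
    (hw : w ∈ orbitClosure x) (m : ℤ) :
    code x (p N) c (hps.2.1 N).1 (shiftZ (tc c (p N) (res x (p N) w + m) - res x (p N) w) w) =
      shiftZ m (code x (p N) c (hps.2.1 N).1 w) := by
  have hP := (hps.2.1 N).1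
  have hP' : (0 : ℤ) < p N := by exact_mod_cast hP
  funext n
  change _ = code x (p N) c hP w (n + m)
  rw [code_eq_iff, res_shift hps hw, add_sub_cancel, tc_emod]
  set ρ := res x (p N) w
  constructor
  · rw [Int.emod_add_emod]; congr 1; ring
  · intro i
    simp only [shiftZ]
    congr 1
    have h := Int.emod_add_mul_ediv (ρ + m) (p N)
    have e1 : ρ + (n + m) = ((ρ + m) % p N + n) + (ρ + m) / p N * p N := by
      linear_combination -h
    rw [e1, tc_add hP]
    simp only [tc]
    ring

theorem code_SP (hps : IsPeriodStructure x p) (hc : 2 ≤ c) {w : ℤ → A}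
    (hw : w ∈ orbitClosure x) :
    code x (p N) c (hps.2.1 N).1 (SP x (p N) c w) =
      shiftMap (code x (p N) c (hps.2.1 N).1 w) := by
  rw [SP_eq hps hc hw, code_shift hps hw]
  rfl

theorem code_inj (hps : IsPeriodStructure x p) (hc : 2 ≤ c) {w w' : ℤ → A}
    (hw : w ∈ orbitClosure x) (hw' : w' ∈ orbitClosure x)
    (h : code x (p N) c (hps.2.1 N).1 w = code x (p N) c (hps.2.1 N).1 w') : w = w' := by
  have hP := (hps.2.1 N).1
  obtain ⟨a0, a1, _⟩ := res_spec (N := N) hps hw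
  obtain ⟨b0, b1, _⟩ := res_spec (N := N) hps hw'
  have hr : res x (p N) w = res x (p N) w' := by
    have h0 := ((code_eq_iff _ _ _ _ _ _).1 (congrFun h 0)).1
    rwa [add_zero, add_zero, Int.emod_eq_of_lt a0 a1, Int.emod_eq_of_lt b0 b1] at h0
  funext k
  obtain ⟨m, i, hmi⟩ := tc_surj hP (show 0 < c by omega) (k + res x (p N) w)
  have h1 := ((code_eq_iff _ _ _ _ _ _).1 (congrFun h (m - res x (p N) w))).2 i
  rw [← hr, add_sub_cancel] at h1
  convert h1 using 2 <;> linear_combination hmi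

theorem code_continuous [Fintype A] (hps : IsPeriodStructure x p)
    [TopologicalSpace (Fin (p N) × (Fin (c * p N) → A))]
    [DiscreteTopology (Fin (p N) × (Fin (c * p N) → A))] :
    Continuous fun w : orbitClosure x => code x (p N) c (hps.2.1 N).1 w.1 := by
  have hP := (hps.2.1 N).1
  apply continuous_pi
  intro n
  have hr : Continuous fun w : orbitClosure x => res x (p N) w.1 := res_continuous hps
  have hc2 : Continuous fun w : orbitClosure x => (res x (p N) w.1,
      fun i : Fin (c * p N) => w.1 (tc c (p N) (res x (p N) w.1 + n) - res x (p N) w.1 + (i : ℕ))) := by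
    refine hr.prodMk (continuous_pi fun i => ?_)
    apply eval_continuous continuous_subtype_val
    have h2 : Continuous fun a : ℤ => tc c (p N) (a + n) - a + (i : ℕ) :=
      continuous_of_discreteTopology
    exact h2.comp hr
  have h3 : Continuous fun q : ℤ × (Fin (c * p N) → A) =>
      ((⟨((q.1 + n) % p N).toNat, by
      have hP' : (0 : ℤ) < p N := by exact_mod_cast hP
      have h0 := Int.emod_nonneg (q.1 + n) hP'.ne'
      have h1 := Int.emod_lt_of_pos (q.1 + n) hP'
      omega⟩, q.2) : Fin (p N) × (Fin (c * p N) → A)) := continuous_of_discreteTopology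
  exact h3.comp hc2

theorem code_conj [Fintype A] (hps : IsPeriodStructure x p) (hc : 2 ≤ c)
    (hgcd : ∀ k, N ≤ k → Nat.gcd c (p (k + 1) / p k) = 1)
    [TopologicalSpace (Fin (p N) × (Fin (c * p N) → A))]
    [DiscreteTopology (Fin (p N) × (Fin (c * p N) → A))] :
    TopConj (orbitClosure x) (SP x (p N) c)
      (orbitClosure (code x (p N) c (hps.2.1 N).1 x)) shiftMap := by
  have hcomp : IsCompact (orbitClosure x) :=
    (isClosed_closure (s := {y | ∃ n : ℤ, shiftZ n x = y})).isCompact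
  have : CompactSpace (orbitClosure x) := isCompact_iff_compactSpace.1 hcomp
  set C := code x (p N) c (hps.2.1 N).1 with hC
  have hcont : Continuous fun w : orbitClosure x => C w.1 := code_continuous hps
  have hcontOn : ContinuousOn C (orbitClosure x) :=
    continuousOn_iff_continuous_domRestrict.2 hcont
  have himg : C '' orbitClosure x = orbitClosure (C x) := by
    apply Set.Subset.antisymm
    · rintro _ ⟨w, hw, rfl⟩
      have h1 : w ∈ closure {v | ∃ k : ℕ, (SP x (p N) c)^[k] x = v} :=
        SP_dense hps hc hgcd (self_mem x) hw
      have hsub : {v | ∃ k : ℕ, (SP x (p N) c)^[k] x = v} ⊆ orbitClosure x := by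
        rintro _ ⟨k, rfl⟩
        rw [SP_iter_self hps hc (self_mem x)]
        exact shiftZ_mem _ (self_mem x)
      have h2 : C w ∈ closure (C '' {v | ∃ k : ℕ, (SP x (p N) c)^[k] x = v}) :=
        ((hcontOn w hw).mono hsub).mem_closure_image h1
      refine closure_mono ?_ h2
      rintro _ ⟨_, ⟨k, rfl⟩, rfl⟩
      refine ⟨k, ?_⟩
      rw [SP_iter_self hps hc (self_mem x), hC, code_shift hps (self_mem x)]
    · apply closure_minimal
      · rintro _ ⟨n, rfl⟩
        exact ⟨_, shiftZ_mem _ (self_mem x), code_shift hps (self_mem x) n⟩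
      · exact (hcomp.image_of_continuousOn hcontOn).isClosed
  have hmem : ∀ w : orbitClosure x, C w.1 ∈ orbitClosure (C x) := fun w => by
    rw [← himg]; exact ⟨w.1, w.2, rfl⟩
  let f : orbitClosure x → orbitClosure (C x) := fun w => ⟨C w.1, hmem w⟩
  have hf : Continuous f := hcont.subtype_mk _
  have hbij : Function.Bijective f := by
    constructor
    · intro w w' h
      exact Subtype.ext (code_inj hps hc w.2 w'.2 (congrArg Subtype.val h))
    · rintro ⟨v, hv⟩
      rw [← himg] at hv
      obtain ⟨w, hw, rfl⟩ := hv
      exact ⟨⟨w, hw⟩, rfl⟩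
  refine ⟨fun w hw => SP_mem _ hw, fun v hv => ?_,
    Continuous.homeoOfEquivCompactToT2 (f := Equiv.ofBijective f hbij) hf, ?_⟩
  · have := shiftZ_mem 1 hv
    exact this
  · intro w
    apply Subtype.ext
    exact code_SP hps hc w.2

theorem code_x_eq (hps : IsPeriodStructure x p) (n n' : ℤ) :
    code x (p N) c (hps.2.1 N).1 x n = code x (p N) c (hps.2.1 N).1 x n' ↔
      n % p N = n' % p N ∧ ∀ i : Fin (c * p N),
        x (tc c (p N) n + (i : ℕ)) = x (tc c (p N) n' + (i : ℕ)) := by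
  rw [code_eq_iff, res_x hps]
  simp

theorem code_per (hps : IsPeriodStructure x p) :
    (⋃ k, PerSet (code x (p N) c (hps.2.1 N).1 x) (p (N + k))) = Set.univ := by
  have hP := (hps.2.1 N).1
  rw [Set.eq_univ_iff_forall]
  intro n
  rw [Set.mem_iUnion]
  obtain ⟨l, hNl, hl⟩ := perSet_finset hps.2.2.1 hps.2.2.2
    (Finset.univ.image fun i : Fin (c * p N) => tc c (p N) n + (i : ℕ)) N
  refine ⟨l - N, ?_⟩
  rw [Nat.add_sub_cancel' hNl]
  intro m
  have hd : (p N : ℤ) ∣ m * p l :=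
    Dvd.dvd.mul_left (Int.natCast_dvd_natCast.2 (p_dvd hps hNl)) m
  rw [code_x_eq hps]
  refine ⟨?_, fun i => ?_⟩
  · exact Int.emod_eq_emod_iff_emod_sub_eq_zero.2
      (Int.emod_eq_zero_of_dvd (by rwa [add_sub_cancel_left]))
  · rw [tc_add_dvd hP _ hd]
    have hi := hl _ (Finset.mem_image_of_mem _ (Finset.mem_univ i))
    have := perSet_val hi (show (p l : ℤ) ∣ c * (m * p l) from
      Dvd.dvd.mul_left (Dvd.intro_left _ rfl) _)
    rw [← this]; congr 1; ring

theorem code_not_periodic (hps : IsPeriodStructure x p) (hc : 2 ≤ c) (hnp : ¬ IsPeriodicSeq x) :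
    ¬ IsPeriodicSeq (code x (p N) c (hps.2.1 N).1 x) := by
  have hP := (hps.2.1 N).1
  rintro ⟨n, hn, h⟩
  apply hnp
  refine ⟨c * n, Nat.mul_pos (by omega) hn, fun k => ?_⟩
  obtain ⟨m, i, rfl⟩ := tc_surj hP (show 0 < c by omega) k
  obtain ⟨h1, h2⟩ := (code_x_eq hps _ _).1 (h m)
  have hd : (p N : ℤ) ∣ n := by
    have := Int.emod_eq_emod_iff_emod_sub_eq_zero.1 h1
    rw [add_sub_cancel_left] at this
    exact Int.dvd_of_emod_eq_zero this
  have h3 := h2 i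
  rw [tc_add_dvd hP _ hd] at h3
  rw [← h3]; congr 1; push_cast; ring

/-- Elements of the stabilizer of a large skeleton of the code respect any finite part of `x`. -/
theorem code_stab_finset (hps : IsPeriodStructure x p) (hc : 2 ≤ c) (F : Finset ℤ) :
    ∃ j, ∀ t ∈ Stab (code x (p N) c (hps.2.1 N).1 x) (p (N + j)),
      (p N : ℤ) ∣ t ∧ ∀ i ∈ F, x (i + c * t) = x i := by
  have hP := (hps.2.1 N).1
  choose f g hfg using tc_surj hP (show 0 < c by omega)
  obtain ⟨j, _, hj⟩ := perSet_finset (p := fun k => p (N + k)) (fun k => hps.2.2.1 (N + k))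
    (code_per (c := c) hps) (insert 0 (F.image f)) 0
  refine ⟨j, fun t ht => ?_⟩
  have hval : ∀ n ∈ insert 0 (F.image f), _ :=
    fun n hn => (code_x_eq hps _ _).1 (ht n (hj n hn)).2.2
  have hd : (p N : ℤ) ∣ t := by
    have := (hval 0 (by simp)).1
    rw [zero_add] at this
    exact Int.dvd_of_emod_eq_zero (by simpa using this)
  refine ⟨hd, fun i hi => ?_⟩
  have := (hval (f i) (by simp only [Finset.mem_insert, Finset.mem_image]; exact Or.inr ⟨i, hi, rfl⟩)).2 (g i)
  rw [tc_add_dvd hP _ hd, ← hfg i] at this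
  rw [← this]
  congr 1
  linear_combination hfg i

theorem code_cof (hps : IsPeriodStructure x p) (hc : 2 ≤ c)
    (hgcd : ∀ k, N ≤ k → Nat.gcd c (p (k + 1) / p k) = 1) (k : ℕ) :
    ∃ j, ∀ t ∈ Stab (code x (p N) c (hps.2.1 N).1 x) (p (N + j)), (p (N + k) : ℤ) ∣ t := by
  have hP := (hps.2.1 N).1
  set Q := p (N + k) with hQdef
  have hess : IsEssentialPeriod x Q := hps.2.1 (N + k)
  have hQ : 0 < Q := hess.1
  have hQ' : (0 : ℤ) < Q := by exact_mod_cast hQ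
  have hwit : ∀ i : ℤ, ∃ n : ℤ, i ∉ PerSet x Q → x (i + n * Q) ≠ x i := by
    intro i
    by_cases h : i ∈ PerSet x Q
    · exact ⟨0, fun h' => absurd h h'⟩
    · simp only [PerSet, Set.mem_ofPred_eq, not_forall] at h
      obtain ⟨n, hn⟩ := h
      exact ⟨n, fun _ => hn⟩
  choose wt hwt using hwit
  obtain ⟨j, hj⟩ := code_stab_finset (N := N) hps hc
    (Finset.Ico (0 : ℤ) Q ∪ (Finset.Ico (0 : ℤ) Q).image fun i => i + wt i * Q)
  refine ⟨j, fun t ht => ?_⟩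
  obtain ⟨hPt, hval⟩ := hj t ht
  have hmodmem : ∀ i : ℤ, i % Q ∈ Finset.Ico (0 : ℤ) Q := fun i => by
    rw [Finset.mem_Ico]
    exact ⟨Int.emod_nonneg _ hQ'.ne', Int.emod_lt_of_pos _ hQ'⟩
  have hv1 : ∀ i : ℤ, x (i % Q + c * t) = x (i % Q) := fun i =>
    hval _ (Finset.mem_union_left _ (hmodmem i))
  have hv2 : ∀ i : ℤ, x (i % Q + wt (i % Q) * Q + c * t) = x (i % Q + wt (i % Q) * Q) := fun i =>
    hval _ (Finset.mem_union_right _ (Finset.mem_image_of_mem _ (hmodmem i)))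
  have hperiod : ∀ i m : ℤ, i + m * Q ∈ PerSet x Q ↔ i ∈ PerSet x Q := by
    intro i m
    refine ⟨fun h => ?_, fun h => perSet_add h m⟩
    have := perSet_add h (-m)
    convert this using 1; ring
  have hmodrep : ∀ i : ℤ, i = i % Q + i / Q * Q := fun i => by
    have := Int.emod_add_mul_ediv i Q
    linear_combination -this
  have hnon : ∀ i : ℤ, i ∉ PerSet x Q → i + c * t ∉ PerSet x Q := by
    intro i hi hi2
    have h1 : i % Q ∉ PerSet x Q := by
      rw [hmodrep i, hperiod] at hi; exact hi
    have h2 : i % Q + c * t ∈ PerSet x Q := by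
      have e : i + c * t = i % Q + c * t + i / Q * Q := by linear_combination hmodrep i
      rw [e, hperiod] at hi2; exact hi2
    apply hwt _ h1
    rw [← hv1, ← hv2, ← h2 (wt (i % Q))]
    congr 1; ring
  have hnon' : ∀ (n : ℕ) (i : ℤ), i ∉ PerSet x Q → i + n * (c * t) ∉ PerSet x Q := by
    intro n i hi
    induction n with
    | zero => simpa using hi
    | succ n ih =>
      have := hnon _ ih
      convert this using 2
      push_cast; ring
  have hst : (c * t : ℤ) ∈ Stab x Q := by
    apply stab_mk hQ
    intro i hi
    have h1 : i + c * t ∈ PerSet x Q := by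
      by_contra hcon
      apply hnon' (Q - 1) _ hcon
      have := perSet_add hi (c * t)
      convert this using 1
      push_cast [show 1 ≤ Q from hQ]; ring
    refine ⟨h1, ?_⟩
    have h2 := h1 (-(i / Q))
    have h3 := hi (-(i / Q))
    rw [← h2, ← h3]
    have e1 : i + -(i / Q) * Q = i % Q := by linear_combination hmodrep i
    have e2 : i + c * t + -(i / Q) * Q = i % Q + c * t := by linear_combination hmodrep i
    rw [e1, e2, hv1]
  have hdvd := (ess_iff hQ).1 hess _ hst
  -- remove the factor `c`
  obtain ⟨d, hd⟩ := p_dvd hps (Nat.le_add_right N k)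
  have hcop : Nat.Coprime c d := by
    have := p_coprime hps hgcd (Nat.le_add_right N k)
    rwa [hd, Nat.mul_div_cancel_left _ hP] at this
  obtain ⟨s, rfl⟩ := hPt
  have hP' : (p N : ℤ) ≠ 0 := by exact_mod_cast hP.ne'
  rw [hQdef, hd] at hdvd ⊢
  push_cast at hdvd ⊢
  rw [mul_left_comm] at hdvd
  have h5 := (mul_dvd_mul_iff_left hP').1 hdvd
  apply mul_dvd_mul_left
  have hco : IsCoprime (d : ℤ) c := (Nat.isCoprime_iff_coprime.2 hcop).symm
  exact hco.dvd_of_dvd_mul_left h5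

end Main

end Helpers

/-- if gcd(c, p_{k+1}/p_k) = 1 eventually, then (X, σ) has a minimal
bounded speedup with orbit number c which is a Toeplitz flow with the same underlying
odometer, and which is not conjugate to (X, σ). -/
theorem statement11 {A : Type} [Fintype A] [TopologicalSpace A] [DiscreteTopology A]
    (x : ℤ → A) (hx : IsToeplitz x) (hnp : ¬ IsPeriodicSeq x)
    (p : ℕ → ℕ) (hps : IsPeriodStructure x p)
    (c : ℕ) (hc : 2 ≤ c)
    (N : ℕ) (hgcd : ∀ k, N ≤ k → Nat.gcd c (p (k + 1) / p k) = 1) :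
    ∃ pf : (ℤ → A) → ℕ,
      (∀ y ∈ orbitClosure x, 1 ≤ pf y) ∧
      ContinuousOn pf (orbitClosure x) ∧
      RestrictsToHomeomorph (fun y => shiftMap^[pf y] y) (orbitClosure x) ∧
      MinimalOn (fun y => shiftMap^[pf y] y) (orbitClosure x) ∧
      OrbitNumberOn shiftMap (fun y => shiftMap^[pf y] y) (orbitClosure x) c ∧
      (∃ (B : Type) (_ : Fintype B) (z : ℤ → B) (q : ℕ → ℕ),
        IsToeplitz z ∧ ¬ IsPeriodicSeq z ∧ IsPeriodStructure z q ∧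
        (∀ k, ∃ j, p k ∣ q j) ∧ (∀ k, ∃ j, q k ∣ p j) ∧
        (letI : TopologicalSpace B := ⊥
         TopConj (orbitClosure x) (fun y => shiftMap^[pf y] y)
           (orbitClosure z) shiftMap)) ∧
      ¬ TopConj (orbitClosure x) (fun y => shiftMap^[pf y] y) (orbitClosure x) shiftMap := by
  have hP := (hps.2.1 N).1
  refine ⟨spd x (p N) c, ?_, spd_continuous hps, SP_homeo hps hc, SP_minimal hps hc hgcd,
    SP_orbitNumber hps hc, ?_, SP_not_conj hx hnp hps hc⟩
  · intro y _
    unfold spd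
    split_ifs <;> omega
  · obtain ⟨q, hq1, hq2, hq3⟩ := exists_period_structure
      (code x (p N) c hP x) (fun k => p (N + k)) (fun k => (hps.2.1 _).1)
      (fun a b hab => hps.1 (by omega)) (fun k => hps.2.2.1 (N + k)) (code_per hps)
      (code_cof hps hc hgcd)
    refine ⟨Fin (p N) × (Fin (c * p N) → A), inferInstance, code x (p N) c hP x, q, ?_,
      code_not_periodic hps hc hnp, hq1, ?_, ?_, ?_⟩
    · intro i
      obtain ⟨l, _, hl⟩ := perSet_finset hq1.2.2.1 hq1.2.2.2 {i} 0
      exact ⟨q l, (hq1.2.1 l).1, hl i (by simp)⟩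
    · intro k
      obtain ⟨j, hj⟩ := hq2 k
      exact ⟨j, (p_dvd hps (Nat.le_add_left k N)).trans hj⟩
    · intro k
      obtain ⟨j, hj⟩ := hq3 k
      exact ⟨N + j, hj⟩
    · letI : TopologicalSpace (Fin (p N) × (Fin (c * p N) → A)) := ⊥
      haveI : DiscreteTopology (Fin (p N) × (Fin (c * p N) → A)) := ⟨rfl⟩
      exact code_conj hps hc hgcd

end
end

section
/- Let χ be the substitution on {a,b} with χ(a) = aab and χ(b) = abb, and let X_χ be its substitution subshift. Then there exists a continuous surjection F : X_χ → X_χ satisfying F ∘ σ⁵ = σ ∘ F; that is, (X_χ, σ) is a topological factor of (X_χ, σ⁵). -/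
open Set Topology Classical

noncomputable section

/-- The substitution χ(a) = aab, χ(b) = abb on {a, b} = Fin 2 (a = 0, b = 1). -/
def chi : Fin 2 → List (Fin 2) := fun i => if i = 0 then [0, 0, 1] else [0, 1, 1]

/-- The bi-infinite fixed point: `ff d n` is read off from the last nonzero ternary digit of `n`,
with the value `d` at `0`. -/
def ff (d : Fin 2) (n : ℤ) : Fin 2 :=
  if n = 0 then d else if n % 3 = 0 then ff d (n / 3) else if n % 3 = 1 then 1 else 0
termination_by n.natAbs
decreasing_by omega

lemma ff_zero (d : Fin 2) : ff d 0 = d := by rw [ff]; simp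

lemma ff_one (d : Fin 2) (n : ℤ) (h : n % 3 = 1) : ff d n = 1 := by
  rw [ff, if_neg (by omega), if_neg (by omega), if_pos h]

lemma ff_two (d : Fin 2) (n : ℤ) (h : n % 3 = 2) : ff d n = 0 := by
  rw [ff, if_neg (by omega), if_neg (by omega), if_neg (by omega)]

lemma ff_three (d : Fin 2) (n : ℤ) : ff d (3 * n) = ff d n := by
  by_cases h : n = 0
  · subst h; simp
  · rw [ff, if_neg (by omega), if_pos (by omega)]
    congr 1
    omega

lemma ff_five (d : Fin 2) (N : ℕ) : ∀ n : ℤ, n.natAbs ≤ N → ff (1 - d) (5 * n) = 1 - ff d n := by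
  induction N with
  | zero =>
    intro n hn
    have : n = 0 := by omega
    subst this
    simp [ff_zero]
  | succ N ih =>
    intro n hn
    have h3 : n % 3 = 0 ∨ n % 3 = 1 ∨ n % 3 = 2 := by omega
    rcases h3 with h | h | h
    · obtain ⟨m, rfl⟩ : ∃ m, n = 3 * m := ⟨n / 3, by omega⟩
      rw [show 5 * (3 * m) = 3 * (5 * m) by ring, ff_three, ff_three]
      exact ih m (by omega)
    · rw [ff_one d n h, ff_two _ _ (by omega)]; rfl
    · rw [ff_two d n h, ff_one _ _ (by omega)]; rfl

lemma ff_period (d e : Fin 2) (K : ℕ) : ∀ w t : ℤ, |w| < 3 ^ K → w ≠ 0 →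
    ff d (w + 3 ^ K * t) = ff e w := by
  induction K with
  | zero =>
    intro w t hw h0
    simp at hw
    exact absurd hw h0
  | succ K ih =>
    intro w t hw h0
    have e1 : w + 3 ^ (K + 1) * t = w + 3 * (3 ^ K * t) := by ring
    rw [e1]
    have h3 : w % 3 = 0 ∨ w % 3 = 1 ∨ w % 3 = 2 := by omega
    rcases h3 with h | h | h
    · obtain ⟨m, rfl⟩ : ∃ m, w = 3 * m := ⟨w / 3, by omega⟩
      rw [show 3 * m + 3 * (3 ^ K * t) = 3 * (m + 3 ^ K * t) by ring, ff_three, ff_three]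
      apply ih m t
      · rw [abs_mul, pow_succ] at hw
        simp at hw
        linarith
      · intro hm; apply h0; simp [hm]
    · rw [ff_one _ w h, ff_one _ _ (by omega)]
    · rw [ff_two _ w h, ff_two _ _ (by omega)]

lemma ff_pow (d : Fin 2) (K : ℕ) (t : ℤ) : ff d (3 ^ K * t) = ff d t := by
  induction K with
  | zero => simp
  | succ K ih => rw [show (3 : ℤ) ^ (K + 1) * t = 3 * (3 ^ K * t) by ring, ff_three, ih]

/-- The centre `(3^K - 1)/2` of the block of length `3^K`. -/
def cc : ℕ → ℤ
  | 0 => 0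
  | k + 1 => cc k + 3 ^ k

lemma cc_two (K : ℕ) : 2 * cc K + 1 = 3 ^ K := by
  induction K with
  | zero => simp [cc]
  | succ K ih => rw [cc, pow_succ]; linarith

lemma seqWord_add {A : Type} (x : ℤ → A) (i : ℤ) (m n : ℕ) :
    seqWord x i (m + n) = seqWord x i m ++ seqWord x (i + m) n := by
  unfold seqWord
  rw [List.ofFn_add]
  simp [add_assoc]

lemma seqWord_congr {A : Type} (x y : ℤ → A) (i j : ℤ) (n : ℕ)
    (h : ∀ m : ℕ, m < n → x (i + m) = y (j + m)) : seqWord x i n = seqWord y j n := by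
  unfold seqWord
  congr 1
  funext m
  exact h m m.2

lemma seqWord_inj {A : Type} (x y : ℤ → A) (i j : ℤ) (n : ℕ)
    (h : seqWord x i n = seqWord y j n) (m : ℕ) (hm : m < n) : x (i + m) = y (j + m) := by
  unfold seqWord at h
  exact congrFun (List.ofFn_injective h) ⟨m, hm⟩

lemma seqWord_length {A : Type} (x : ℤ → A) (i : ℤ) (n : ℕ) : (seqWord x i n).length = n := by
  simp [seqWord]

lemma block (K : ℕ) (d e : Fin 2) (t : ℤ) (h : ff d t = e) :
    seqWord (ff d) (-cc K + 3 ^ K * t) (3 ^ K) = seqWord (ff e) (-cc K) (3 ^ K) := by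
  apply seqWord_congr
  intro m hm
  have hm' : (m : ℤ) < 3 ^ K := by exact_mod_cast hm
  have hc := cc_two K
  rw [show -cc K + 3 ^ K * t + (m : ℤ) = (-cc K + m) + 3 ^ K * t by ring]
  by_cases h0 : -cc K + (m : ℤ) = 0
  · rw [h0, zero_add, ff_pow, ff_zero, h]
  · exact ff_period d e K _ t (by rw [abs_lt]; constructor <;> linarith) h0

lemma substPow_eq (K : ℕ) : ∀ d : Fin 2, substPow chi K d = seqWord (ff d) (-cc K) (3 ^ K) := by
  induction K with
  | zero => intro d; simp [substPow, seqWord, cc, ff_zero]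
  | succ K ih =>
    intro d
    have e : chi d = [0, d, 1] := by
      fin_cases d <;> simp [chi]
    rw [substPow, e]
    simp only [List.flatMap_cons, List.flatMap_nil, List.append_nil, ih]
    rw [show 3 ^ (K + 1) = 3 ^ K + (3 ^ K + 3 ^ K) by ring, seqWord_add, seqWord_add,
      ← block K d 0 (-1) (ff_two _ _ (by norm_num)), ← block K d 1 1 (ff_one _ _ (by norm_num)),
      ← block K d d 0 (ff_zero d)]
    have e1 : -cc K + 3 ^ K * (-1) = -cc (K + 1) := by rw [cc]; ring
    have e2 : -cc K + 3 ^ K * 0 = -cc (K + 1) + ((3 ^ K : ℕ) : ℤ) := by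
      rw [cc]; push_cast; ring
    have e3 : -cc K + 3 ^ K * 1 = -cc (K + 1) + ((3 ^ K : ℕ) : ℤ) + ((3 ^ K : ℕ) : ℤ) := by
      rw [cc]; push_cast; ring
    rw [e1, e2, e3]

lemma exists_pow (B : ℤ) : ∃ K : ℕ, B < 3 ^ K := by
  obtain ⟨K, hK⟩ := pow_unbounded_of_one_lt B (show (1 : ℤ) < 3 by norm_num)
  exact ⟨K, hK⟩

lemma mem_iff (x : ℤ → Fin 2) : x ∈ substShift chi ↔
    ∀ (i : ℤ) (n : ℕ), ∃ (d : Fin 2) (s : ℤ), ∀ m : ℕ, m < n → x (i + m) = ff d (s + m) := by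
  constructor
  · intro hx i n
    obtain ⟨k, d, u, v, h⟩ := hx i n
    rw [substPow_eq] at h
    have hl := congrArg List.length h
    simp only [List.length_append, seqWord_length] at hl
    rw [← hl, seqWord_add, seqWord_add] at h
    have h1 := List.append_inj h (by simp [seqWord_length])
    have h2 := List.append_inj h1.1 (by simp [seqWord_length])
    exact ⟨d, _, seqWord_inj _ _ _ _ _ h2.2⟩
  · intro hx i n
    obtain ⟨d, s, h⟩ := hx i n
    obtain ⟨K, hK⟩ := exists_pow (2 * (|s| + n) + 1)
    have hc := cc_two K
    have hs1 := le_abs_self s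
    have hs2 := neg_abs_le s
    refine ⟨K, d, ?_⟩
    rw [substPow_eq, seqWord_congr x (ff d) i s n h]
    obtain ⟨p, hp⟩ : ∃ p : ℕ, (p : ℤ) = s + cc K := ⟨(s + cc K).toNat, by omega⟩
    have h3 : ((3 ^ K : ℕ) : ℤ) = 3 ^ K := by push_cast; rfl
    obtain ⟨q, hq⟩ : ∃ q : ℕ, 3 ^ K = p + n + q := by
      refine ⟨3 ^ K - (p + n), ?_⟩
      omega
    rw [hq, seqWord_add, seqWord_add, show -cc K + (p : ℤ) = s by omega]
    exact ⟨_, _, rfl⟩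

lemma ff_shift_mem (d : Fin 2) (s : ℤ) : (fun j => ff d (s + j)) ∈ substShift chi := by
  rw [mem_iff]
  intro i n
  exact ⟨d, s + i, fun m _ => by simp only [add_assoc]⟩

lemma closed_X : IsClosed (substShift chi) := by
  have : substShift chi = ⋂ (i : ℤ), ⋂ (n : ℕ), (fun (x : ℤ → Fin 2) (m : Fin n) => x (i + (m : ℕ))) ⁻¹'
      {w | ∃ (k : ℕ) (a : Fin 2), (List.ofFn w).IsInfix (substPow chi k a)} := by
    ext x
    simp [substShift, seqWord]
  rw [this]
  refine isClosed_iInter fun i => isClosed_iInter fun n => ?_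
  exact (isClosed_discrete _).preimage (by fun_prop)

/-- The factor map. -/
def FF (x : ℤ → Fin 2) : ℤ → Fin 2 := fun n => 1 - x (5 * n)

lemma FF_cont : Continuous FF := by
  unfold FF
  refine continuous_pi fun n => ?_
  exact (continuous_of_discreteTopology (f := fun c : Fin 2 => 1 - c)).comp (continuous_apply _)

lemma five_inv (K : ℕ) (s : ℤ) : ∃ t s' : ℤ, s + 3 ^ K * t = 5 * s' := by
  have h : IsCoprime ((3 : ℤ) ^ K) 5 :=
    IsCoprime.pow_left (by rw [Int.isCoprime_iff_gcd_eq_one]; rfl)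
  obtain ⟨a, b, hab⟩ := h
  exact ⟨-a * s, b * s, by linear_combination (-s) * hab⟩

lemma FF_maps : Set.MapsTo FF (substShift chi) (substShift chi) := by
  intro x hx
  rw [mem_iff] at hx ⊢
  intro i n
  obtain ⟨d, s, h⟩ := hx (5 * i) (5 * n)
  have key : ∀ m : ℕ, m < n → FF x (i + m) = 1 - ff d (s + 5 * m) := by
    intro m hm
    have := h (5 * m) (by omega)
    push_cast at this
    simp only [FF]
    rw [mul_add, this]
  by_cases hs : s % 5 = 0
  · obtain ⟨s', rfl⟩ : ∃ s', s = 5 * s' := ⟨s / 5, by omega⟩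
    refine ⟨1 - d, s', fun m hm => ?_⟩
    rw [key m hm, ← mul_add]
    have := ff_five (1 - d) _ (s' + m) le_rfl
    rw [sub_sub_cancel] at this
    rw [this, sub_sub_cancel]
  · obtain ⟨K, hK⟩ := exists_pow (|s| + 5 * n)
    obtain ⟨t, s', ht⟩ := five_inv K s
    refine ⟨1 - d, s', fun m hm => ?_⟩
    have hs1 := le_abs_self s
    have hs2 := neg_abs_le s
    rw [key m hm, ← ff_period d d K (s + 5 * m) t (by rw [abs_lt]; constructor <;> linarith [(by exact_mod_cast hm : (m : ℤ) < n)]) (by omega)]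
    rw [show s + 5 * (m : ℤ) + 3 ^ K * t = 5 * (s' + m) by linear_combination ht]
    have := ff_five (1 - d) _ (s' + m) le_rfl
    rw [sub_sub_cancel] at this
    rw [this, sub_sub_cancel]

lemma FF_surj : Set.SurjOn FF (substShift chi) (substShift chi) := by
  intro y hy
  have hcl : IsClosed (FF '' substShift chi) := (closed_X.isCompact.image FF_cont).isClosed
  rw [mem_iff] at hy
  choose d s h using fun N : ℕ => hy (-(N : ℤ)) (2 * N + 1)
  let u : ℕ → (ℤ → Fin 2) := fun N => FF (fun j => ff (1 - d N) (5 * (s N + N) + j))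
  refine hcl.mem_of_tendsto (f := u) (b := Filter.atTop) ?_ (Filter.Eventually.of_forall fun N =>
    ⟨_, ff_shift_mem _ _, rfl⟩)
  rw [tendsto_pi_nhds]
  intro j
  apply tendsto_const_nhds.congr'
  filter_upwards [Filter.eventually_ge_atTop j.natAbs] with N hN
  have h1 := h N (j + N).toNat (by omega)
  rw [show ((j + N).toNat : ℤ) = j + N by omega] at h1
  simp only [u, FF]
  rw [← mul_add, ff_five (d N) _ _ le_rfl, sub_sub_cancel]
  rw [show -(N : ℤ) + (j + N) = j by ring] at h1
  rw [h1]
  congr 1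
  ring

/-- (X_χ, σ^1) is a topological factor of (X_χ, σ^5). -/
theorem statement15 :
    IsFactorOn (substShift chi) (shiftMap^[5]) (substShift chi) (shiftMap^[1]) := by
  refine ⟨FF, FF_maps, FF_cont.continuousOn, FF_surj, fun x _ => ?_⟩
  funext n
  simp only [FF, shiftMap, Function.iterate_succ, Function.iterate_zero, Function.comp, id]
  congr 2
  ring

end
end
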